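/- (i) The composite of the inclusion V^{N̄} ⊆ V with the quotient map V → V_N is a C-linear isomorphism of V^{N̄} onto V_N. (ii) For every g ∈ GL_n(F_q), the image of the subspace g·V^{N̄} under the quotient map V → V_N is nonzero if and only if g ∈ P·P̄_V·P̄. -/

import Mathlib

open Matrix

namespace GLFix

section Groups

variable {F : Type} [Field F] {n : ℕ} {α β : Type} [LinearOrder α] [LinearOrder β]

/-- The parabolic subgroup of `GL_n` attached to a block function `c`. -/
def par (F : Type) [Field F] (c : Fin n → α) : Subgroup (GL (Fin n) F) where
  carrier := {g | (g : Matrix (Fin n) (Fin n) F).BlockTriangular c}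
  mul_mem' := by
    intro g h hg hh
    simpa using BlockTriangular.mul hg hh
  one_mem' := by simpa using blockTriangular_one
  inv_mem' := by
    intro g hg
    have : Invertible (g : Matrix (Fin n) (Fin n) F) := g.invertible
    simpa using blockTriangular_inv_of_blockTriangular hg

theorem mem_par {c : Fin n → α} {g : GL (Fin n) F} :
    g ∈ par F c ↔ ∀ i j, c j < c i → (g : Matrix (Fin n) (Fin n) F) i j = 0 := by
  constructor
  · intro h i j hij; exact h hij
  · intro h i j hij; exact h i j hij

/-- `X` is strictly block upper triangular with respect to `c`. -/
def StrictTri (c : Fin n → α) (X : Matrix (Fin n) (Fin n) F) : Prop :=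
  ∀ i j, X i j ≠ 0 → c i < c j

theorem StrictTri.tri_mul {c : Fin n → α} {A X : Matrix (Fin n) (Fin n) F}
    (hA : A.BlockTriangular c) (hX : StrictTri c X) : StrictTri c (A * X) := by
  intro i j h
  rw [mul_apply] at h
  obtain ⟨k, -, hk⟩ := Finset.exists_ne_zero_of_sum_ne_zero h
  have h1 : c i ≤ c k := by
    by_contra hlt
    exact hk (by rw [hA (not_le.mp hlt), zero_mul])
  exact h1.trans_lt (hX _ _ (right_ne_zero_of_mul hk))

theorem StrictTri.mul_tri {c : Fin n → α} {A X : Matrix (Fin n) (Fin n) F}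
    (hX : StrictTri c X) (hA : A.BlockTriangular c) : StrictTri c (X * A) := by
  intro i j h
  rw [mul_apply] at h
  obtain ⟨k, -, hk⟩ := Finset.exists_ne_zero_of_sum_ne_zero h
  have h1 : c k ≤ c j := by
    by_contra hlt
    exact hk (by rw [hA (not_le.mp hlt), mul_zero])
  exact (hX _ _ (left_ne_zero_of_mul hk)).trans_le h1

theorem StrictTri.add {c : Fin n → α} {X Y : Matrix (Fin n) (Fin n) F}
    (hX : StrictTri c X) (hY : StrictTri c Y) : StrictTri c (X + Y) := by
  intro i j h
  by_contra hlt
  apply h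
  rw [Matrix.add_apply, not_imp_comm.mp (hX i j) hlt, not_imp_comm.mp (hY i j) hlt, add_zero]

theorem StrictTri.neg {c : Fin n → α} {X : Matrix (Fin n) (Fin n) F}
    (hX : StrictTri c X) : StrictTri c (-X) :=
  fun i j h => hX i j (by simpa using h)

theorem StrictTri.isNilpotent {c : Fin n → α} {X : Matrix (Fin n) (Fin n) F}
    (hX : StrictTri c X) : IsNilpotent X := by
  have key : ∀ k i j, (X ^ k) i j ≠ 0 → k ≤ (Finset.univ.filter (fun l => c l < c j)).card := by
    intro k
    induction k with
    | zero => intros; exact Nat.zero_le _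
    | succ k ih =>
      intro i j h
      rw [pow_succ, mul_apply] at h
      obtain ⟨l, -, hl⟩ := Finset.exists_ne_zero_of_sum_ne_zero h
      have h1 := ih i l (left_ne_zero_of_mul hl)
      have h2 := hX _ _ (right_ne_zero_of_mul hl)
      refine Nat.succ_le_of_lt (h1.trans_lt (Finset.card_lt_card ?_))
      refine Finset.ssubset_iff_of_subset ?_ |>.mpr ⟨l, by simpa using h2, by simp⟩
      intro m hm
      simp only [Finset.mem_filter, Finset.mem_univ, true_and] at hm ⊢
      exact hm.trans h2
  refine ⟨n + 1, ?_⟩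
  ext i j
  by_contra h
  have h1 := key _ i j h
  have h2 := Finset.card_le_univ (Finset.univ.filter (fun l => c l < c j))
  rw [Fintype.card_fin] at h2
  omega

theorem StrictTri.blockTriangular {c : Fin n → α} {X : Matrix (Fin n) (Fin n) F}
    (hX : StrictTri c X) : X.BlockTriangular c := by
  intro i j h
  by_contra h0
  exact (hX i j h0).asymm h

/-- The unipotent radical of `par F c`. -/
def rad (F : Type) [Field F] (c : Fin n → α) : Subgroup (GL (Fin n) F) where
  carrier := {g | StrictTri c ((g : Matrix (Fin n) (Fin n) F) - 1)}
  mul_mem' := by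
    intro g h hg hh
    have hh' : (h : Matrix (Fin n) (Fin n) F).BlockTriangular c := by
      simpa using (hh.blockTriangular).add blockTriangular_one
    have := (hg.mul_tri hh').add hh
    simpa [sub_mul] using this
  one_mem' := by intro i j h; simp at h
  inv_mem' := by
    intro g hg
    have hg' : g ∈ par F c := by
      have : (g : Matrix (Fin n) (Fin n) F).BlockTriangular c := by
        simpa using (hg.blockTriangular).add blockTriangular_one
      exact this
    have h1 : (↑(g⁻¹) : Matrix (Fin n) (Fin n) F).BlockTriangular c := (par F c).inv_mem hg'
    have := (StrictTri.tri_mul h1 hg).neg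
    have e : (↑(g⁻¹) : Matrix (Fin n) (Fin n) F) * (g : Matrix (Fin n) (Fin n) F) = 1 := by
      rw [← Units.val_mul]; simp
    rw [mul_sub, e, mul_one, neg_sub] at this
    exact this

theorem mem_rad {c : Fin n → α} {g : GL (Fin n) F} :
    g ∈ rad F c ↔ ∀ i j, ¬ (c i < c j) → (g : Matrix (Fin n) (Fin n) F) i j =
      (1 : Matrix (Fin n) (Fin n) F) i j := by
  constructor
  · intro h i j hij
    have := not_imp_comm.mp (h i j) hij
    rwa [Matrix.sub_apply, sub_eq_zero] at this
  · intro h i j hij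
    by_contra hlt
    exact hij (by rw [Matrix.sub_apply, h i j hlt, sub_self])

theorem mem_rad' {c : Fin n → α} {g : GL (Fin n) F} :
    g ∈ rad F c ↔ StrictTri c ((g : Matrix (Fin n) (Fin n) F) - 1) := Iff.rfl

theorem rad_le_par (c : Fin n → α) : rad F c ≤ par F c := by
  intro g hg
  have : (g : Matrix (Fin n) (Fin n) F).BlockTriangular c := by
    simpa using (StrictTri.blockTriangular hg).add blockTriangular_one
  exact this

theorem conj_mem_rad {c : Fin n → α} {g h : GL (Fin n) F} (hg : g ∈ par F c) (hh : h ∈ rad F c) :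
    g * h * g⁻¹ ∈ rad F c := by
  have h1 : (↑(g⁻¹) : Matrix (Fin n) (Fin n) F).BlockTriangular c := (par F c).inv_mem hg
  have := (StrictTri.tri_mul hg hh).mul_tri h1
  have e : (g : Matrix (Fin n) (Fin n) F) * (↑(g⁻¹) : Matrix (Fin n) (Fin n) F) = 1 := by
    rw [← Units.val_mul]; simp
  rw [mul_sub, sub_mul, mul_one, e] at this
  rw [mem_rad']
  simpa using this

theorem rad_mono {c : Fin n → α} {d : Fin n → β} (h : ∀ i j, c i < c j → d i < d j) :
    rad F c ≤ rad F d := by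
  intro g hg i j hij
  exact h _ _ (hg i j hij)

theorem par_mono {c : Fin n → α} {d : Fin n → β} (h : ∀ i j, d i < d j → c i < c j) :
    par F c ≤ par F d := by
  intro g hg i j hij
  exact hg (h _ _ hij)

theorem isPGroup_rad (p : ℕ) [Fact p.Prime] [CharP F p] (c : Fin n → α) :
    IsPGroup p (rad F c) := by
  rintro ⟨g, hg⟩
  obtain ⟨k, hk⟩ := StrictTri.isNilpotent hg
  refine ⟨k, ?_⟩
  ext : 2
  have hp : 1 < p := (Fact.out : p.Prime).one_lt
  rcases Nat.eq_zero_or_pos n with rfl | hn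
  · ext i; exact i.elim0
  have : Nonempty (Fin n) := ⟨⟨0, hn⟩⟩
  have h1 : ((g : Matrix (Fin n) (Fin n) F) - 1) ^ p ^ k = 0 :=
    pow_eq_zero_of_le (Nat.lt_pow_self hp).le hk
  rw [sub_pow_char_pow_of_commute p k (Commute.one_right _), one_pow, sub_eq_zero] at h1
  simpa using h1

/-- Splitting off the block diagonal part of a unipotent element. -/
theorem exists_rad_mul {c : Fin n → α} {b : Fin n → β} (hcb : ∀ i j, c i < c j → b i ≤ b j)
    {u : GL (Fin n) F} (hu : u ∈ rad F c) :
    ∃ x ∈ rad F b, ∃ m ∈ rad F c, u = x * m ∧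
      ∀ i j, (m : Matrix (Fin n) (Fin n) F) i j =
        if b i = b j then (u : Matrix (Fin n) (Fin n) F) i j else 0 := by
  set M : Matrix (Fin n) (Fin n) F :=
    Matrix.of (fun i j => if b i = b j then (u : Matrix (Fin n) (Fin n) F) i j else 0) with hM
  have hM1 : StrictTri c (M - 1) := by
    intro i j h
    by_contra hlt
    apply h
    by_cases hb : b i = b j
    · simp [hM, hb, mem_rad.mp hu i j hlt]
    · have : i ≠ j := fun h => hb (by rw [h])
      simp [hM, hb, this]
  have hMu : IsUnit M := by
    simpa using hM1.isNilpotent.isUnit_one_add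
  obtain ⟨m, hm⟩ := hMu
  have hmt : m ∈ par F b := by
    rw [mem_par]
    intro i j hij
    rw [show (m : Matrix (Fin n) (Fin n) F) = M from hm]
    simp [hM, hij.ne']
  have hmc : m ∈ rad F c := by rw [mem_rad', show (m : Matrix (Fin n) (Fin n) F) = M from hm]; exact hM1
  refine ⟨u * m⁻¹, ?_, m, hmc, by simp, ?_⟩
  · have hd : StrictTri b ((u : Matrix (Fin n) (Fin n) F) - (m : Matrix (Fin n) (Fin n) F)) := by
      intro i j h
      rw [show (m : Matrix (Fin n) (Fin n) F) = M from hm] at h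
      by_cases hb : b i = b j
      · simp [hM, hb] at h
      · simp only [hM, Matrix.sub_apply, of_apply, hb, if_false, sub_zero] at h
        have hij : i ≠ j := fun h => hb (by rw [h])
        refine lt_of_le_of_ne (hcb i j ?_) hb
        by_contra hlt
        exact h (by rw [mem_rad.mp hu i j hlt, one_apply_ne hij])
    have h1 : (↑(m⁻¹) : Matrix (Fin n) (Fin n) F).BlockTriangular b := (par F b).inv_mem hmt
    have e : (m : Matrix (Fin n) (Fin n) F) * (↑(m⁻¹) : Matrix (Fin n) (Fin n) F) = 1 := by
      rw [← Units.val_mul]; simp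
    have := hd.mul_tri h1
    rw [sub_mul, e] at this
    rw [mem_rad']
    simpa using this
  · intro i j
    rw [show (m : Matrix (Fin n) (Fin n) F) = M from hm]
    simp [hM]

end Groups

section Perms

/-- Removing an inversion of a permutation `w` increases `∑ k * w k`. -/
theorem sum_mul_swap_lt {n : ℕ} (w : Equiv.Perm (Fin n)) {i j : Fin n} (hij : i < j)
    (hw : w j < w i) :
    ∑ k : Fin n, ((k : ℕ) : ℤ) * ((w k : ℕ) : ℤ) <
      ∑ k : Fin n, ((k : ℕ) : ℤ) * (((w * Equiv.swap i j) k : ℕ) : ℤ) := by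
  rw [← sub_pos, ← Finset.sum_sub_distrib, Fintype.sum_eq_add i j hij.ne]
  · simp only [Equiv.Perm.mul_apply, Equiv.swap_apply_left, Equiv.swap_apply_right]
    have h1 : ((i : ℕ) : ℤ) < ((j : ℕ) : ℤ) := by exact_mod_cast hij
    have h2 : ((w j : ℕ) : ℤ) < ((w i : ℕ) : ℤ) := by exact_mod_cast hw
    nlinarith [mul_pos (sub_pos.mpr h1) (sub_pos.mpr h2)]
  · rintro k ⟨h1, h2⟩
    simp [Equiv.swap_apply_of_ne_of_ne h1 h2]

/-- Induction on permutations of `Fin n` through adjacent transpositions creating an inversion. -/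
theorem perm_induction {n : ℕ} (P : Equiv.Perm (Fin n) → Prop) (h1 : P 1)
    (hs : ∀ (w : Equiv.Perm (Fin n)) (i j : Fin n), (i : ℕ) + 1 = j → w i < w j → P w →
      P (w * Equiv.swap i j)) (w : Equiv.Perm (Fin n)) : P w := by
  classical
  by_contra hw
  obtain ⟨m, hm, hmax⟩ := Finset.exists_max_image (Finset.univ.filter (fun w => ¬ P w))
    (fun w => ∑ k : Fin n, ((k : ℕ) : ℤ) * ((w k : ℕ) : ℤ)) ⟨w, by simpa using hw⟩
  simp only [Finset.mem_filter, Finset.mem_univ, true_and] at hm hmax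
  by_cases hasc : ∃ i j : Fin n, (i : ℕ) + 1 = j ∧ m j < m i
  · obtain ⟨i, j, hij, hmij⟩ := hasc
    have hlt : i < j := by rw [Fin.lt_def]; omega
    by_cases hP : P (m * Equiv.swap i j)
    · have := hs (m * Equiv.swap i j) i j hij (by simpa using hmij) hP
      rw [mul_assoc, Equiv.swap_mul_self, mul_one] at this
      exact hm this
    · exact absurd (hmax _ hP) (not_le.mpr (sum_mul_swap_lt m hlt hmij))
  · push Not at hasc
    have hmono : StrictMono m := by
      cases n with
      | zero => intro i; exact i.elim0
      | succ n =>
        rw [Fin.strictMono_iff_lt_succ]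
        intro i
        refine lt_of_le_of_ne (hasc _ _ (by simp)) ?_
        intro h
        exact absurd (m.injective h) (Fin.castSucc_lt_succ).ne
    apply hm
    have : m = 1 := by
      ext i
      have : m i = i := by
        have h2 : (hmono.orderIsoOfSurjective m m.surjective) = OrderIso.refl _ :=
          Subsingleton.elim _ _
        have := congrArg (fun f => f i) h2
        simpa using this
      rw [this]; rfl
    rw [this]; exact h1

end Perms

section Elements

variable {F : Type} [Field F] {n : ℕ} {α : Type} [LinearOrder α]

/-- Permutation matrices in `GL_n`. -/
def pm (F : Type) [Field F] {n : ℕ} : Equiv.Perm (Fin n) →* GL (Fin n) F :=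
  MonoidHom.toHomUnits
    { toFun := fun σ => Matrix.of (fun i j => if i = σ j then (1 : F) else 0)
      map_one' := by ext i j; simp only [of_apply, one_apply, Equiv.Perm.one_apply]; congr
      map_mul' := by
        intro σ τ
        ext i j
        simp only [of_apply, mul_apply, Equiv.Perm.mul_apply]
        rw [Finset.sum_eq_single (τ j)]
        · by_cases h : i = σ (τ j) <;> simp [h]
        · intro k _ hk; simp [hk]
        · simp }

theorem pm_apply (σ : Equiv.Perm (Fin n)) (i j : Fin n) :
    (pm F σ : Matrix (Fin n) (Fin n) F) i j = if i = σ j then 1 else 0 := rfl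

theorem pm_mul_apply (σ : Equiv.Perm (Fin n)) (M : Matrix (Fin n) (Fin n) F) (i j : Fin n) :
    ((pm F σ : Matrix (Fin n) (Fin n) F) * M) i j = M (σ⁻¹ i) j := by
  rw [mul_apply, Finset.sum_eq_single (σ⁻¹ i)]
  · simp [pm_apply]
  · intro k _ hk
    rw [pm_apply, if_neg, zero_mul]
    rintro rfl
    simp at hk
  · simp

theorem mul_pm_apply (σ : Equiv.Perm (Fin n)) (M : Matrix (Fin n) (Fin n) F) (i j : Fin n) :
    (M * (pm F σ : Matrix (Fin n) (Fin n) F)) i j = M i (σ j) := by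
  rw [mul_apply, Finset.sum_eq_single (σ j)]
  · simp [pm_apply]
  · intro k _ hk
    rw [pm_apply, if_neg hk, mul_zero]
  · simp

theorem pm_conj_apply (σ : Equiv.Perm (Fin n)) (g : GL (Fin n) F) (i j : Fin n) :
    (↑(pm F σ * g * (pm F σ)⁻¹) : Matrix (Fin n) (Fin n) F) i j =
      (g : Matrix (Fin n) (Fin n) F) (σ⁻¹ i) (σ⁻¹ j) := by
  rw [← map_inv, Units.val_mul, mul_pm_apply, Units.val_mul, pm_mul_apply]

theorem pm_conj_mem_rad (σ : Equiv.Perm (Fin n)) {c : Fin n → α} {g : GL (Fin n) F} :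
    pm F σ * g * (pm F σ)⁻¹ ∈ rad F c ↔ g ∈ rad F (c ∘ σ) := by
  simp only [mem_rad, pm_conj_apply]
  constructor
  · intro h i j hij
    simpa [one_apply] using h (σ i) (σ j) hij
  · intro h i j hij
    have := h (σ⁻¹ i) (σ⁻¹ j) (by simpa using hij)
    simpa [one_apply] using this

/-- Elementary unipotent elements of `GL_n`. -/
def tv {i j : Fin n} (h : i ≠ j) (a : F) : GL (Fin n) F where
  val := transvection i j a
  inv := transvection i j (-a)
  val_inv := by simp [transvection_mul_transvection_same, h]
  inv_val := by simp [transvection_mul_transvection_same, h]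

theorem tv_apply {i j : Fin n} (h : i ≠ j) (a : F) (k l : Fin n) :
    (tv h a : Matrix (Fin n) (Fin n) F) k l =
      (1 : Matrix (Fin n) (Fin n) F) k l + if i = k ∧ j = l then a else 0 := by
  change transvection i j a k l = _
  simp [transvection, single_apply]

theorem tv_zero {i j : Fin n} (h : i ≠ j) : tv h (0 : F) = 1 := by
  ext : 1; simp [tv]

theorem tv_mul {i j : Fin n} (h : i ≠ j) (a b : F) : tv h a * tv h b = tv h (a + b) := by
  ext : 1; simp [tv, transvection_mul_transvection_same, h]

theorem tv_mem_rad {i j : Fin n} (h : i ≠ j) (a : F) {c : Fin n → α} (hc : c i < c j) :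
    tv h a ∈ rad F c := by
  rw [mem_rad]
  intro k l hkl
  rw [tv_apply, if_neg, add_zero]
  rintro ⟨rfl, rfl⟩
  exact hkl hc

theorem tv_mem_par {i j : Fin n} (h : i ≠ j) (a : F) {c : Fin n → α} (hc : c i ≤ c j) :
    tv h a ∈ par F c := by
  rw [mem_par]
  intro k l hkl
  have : k ≠ l := by rintro rfl; exact lt_irrefl _ hkl
  rw [tv_apply, if_neg, add_zero, one_apply_ne this]
  rintro ⟨rfl, rfl⟩
  exact absurd hc (not_le.mpr hkl)

theorem pm_mul_tv (σ : Equiv.Perm (Fin n)) {i j : Fin n} (h : i ≠ j) (a : F) :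
    pm F σ * tv h a = tv (σ.injective.ne h) a * pm F σ := by
  rw [← mul_inv_eq_iff_eq_mul]
  ext k l
  rw [pm_conj_apply, tv_apply, tv_apply]
  simp only [one_apply, Equiv.Perm.eq_inv_iff_eq, σ⁻¹.injective.eq_iff]

/-- The diagonal torus. -/
def tor (F : Type) [Field F] (n : ℕ) : Subgroup (GL (Fin n) F) :=
  par F (id : Fin n → Fin n) ⊓ par F (OrderDual.toDual : Fin n → (Fin n)ᵒᵈ)

theorem mem_tor {g : GL (Fin n) F} :
    g ∈ tor F n ↔ ∀ i j, i ≠ j → (g : Matrix (Fin n) (Fin n) F) i j = 0 := by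
  simp only [tor, Subgroup.mem_inf, mem_par, id, OrderDual.toDual_lt_toDual]
  constructor
  · rintro ⟨h1, h2⟩ i j hij
    rcases lt_or_gt_of_ne hij with h | h
    exacts [h2 _ _ h, h1 _ _ h]
  · intro h
    exact ⟨fun i j hij => h _ _ hij.ne', fun i j hij => h _ _ hij.ne⟩

theorem tor_le_par (c : Fin n → α) : tor F n ≤ par F c := by
  intro g hg
  rw [mem_par]
  intro i j hij
  exact mem_tor.mp hg _ _ (by rintro rfl; exact lt_irrefl _ hij)

theorem pm_conj_mem_tor (σ : Equiv.Perm (Fin n)) {g : GL (Fin n) F} (hg : g ∈ tor F n) :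
    pm F σ * g * (pm F σ)⁻¹ ∈ tor F n := by
  rw [mem_tor] at hg ⊢
  intro i j hij
  rw [pm_conj_apply]
  exact hg _ _ (σ⁻¹.injective.ne hij)

theorem tor_mul_comm {g h : GL (Fin n) F} (hg : g ∈ tor F n) (hh : h ∈ tor F n) :
    g * h = h * g := by
  rw [mem_tor] at hg hh
  ext i j
  simp only [Units.val_mul, mul_apply]
  rw [Finset.sum_eq_single i, Finset.sum_eq_single i]
  · by_cases h : i = j
    · subst h; ring
    · rw [hg _ _ h, hh _ _ h]; ring
  · intro k _ hk; rw [hh _ _ hk.symm, zero_mul]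
  · simp
  · intro k _ hk; rw [hg _ _ hk.symm, zero_mul]
  · simp

/-- Diagonal elements. -/
def dg (d : Fin n → Fˣ) : GL (Fin n) F where
  val := diagonal (fun i => (d i : F))
  inv := diagonal (fun i => ((d i)⁻¹ : Fˣ))
  val_inv := by simp
  inv_val := by simp

theorem dg_mem_tor (d : Fin n → Fˣ) : dg d ∈ tor F n := by
  rw [mem_tor]; intro i j hij; exact diagonal_apply_ne _ hij

theorem dg_mul (d e : Fin n → Fˣ) : dg d * dg e = dg (d * e) := by
  ext : 1; simp [dg]

theorem tor_ne_zero {t : GL (Fin n) F} (ht : t ∈ tor F n) (i : Fin n) :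
    (t : Matrix (Fin n) (Fin n) F) i i ≠ 0 := by
  intro h
  rw [mem_tor] at ht
  have e : (t : Matrix (Fin n) (Fin n) F) * (↑(t⁻¹) : Matrix (Fin n) (Fin n) F) = 1 := by
    rw [← Units.val_mul]; simp
  have := congrFun (congrFun e i) i
  rw [mul_apply, Finset.sum_eq_single i, h, zero_mul, one_apply_eq] at this
  · exact zero_ne_one this
  · intro k _ hk; rw [ht _ _ hk.symm, zero_mul]
  · simp

theorem tor_mul_tv {t : GL (Fin n) F} (ht : t ∈ tor F n) {i j : Fin n} (h : i ≠ j) (a : F) :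
    t * tv h a = tv h ((t : Matrix (Fin n) (Fin n) F) i i * a *
      ((t : Matrix (Fin n) (Fin n) F) j j)⁻¹) * t := by
  have hj := tor_ne_zero ht j
  rw [mem_tor] at ht
  ext k l
  change ((t : Matrix (Fin n) (Fin n) F) * transvection i j a) k l =
    (transvection i j ((t : Matrix (Fin n) (Fin n) F) i i * a *
      ((t : Matrix (Fin n) (Fin n) F) j j)⁻¹) * (t : Matrix (Fin n) (Fin n) F)) k l
  by_cases hl : l = j <;> by_cases hk : k = i
  · subst hl hk; simp [hj]; ring
  · subst hl; simp [hk, ht _ _ hk]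
  · subst hk; simp [hl, ht _ _ (Ne.symm hl)]
  · simp [hk, hl]

/-- The diagonal element occurring in the Bruhat decomposition of `s * tv a`. -/
def ta (i j : Fin n) (a : Fˣ) : GL (Fin n) F :=
  dg (fun k => if k = i then -a⁻¹ else if k = j then a else 1)

/-- The coroot attached to `i`, `j`. -/
def coroot (i j : Fin n) (a : Fˣ) : GL (Fin n) F :=
  dg (fun k => if k = i then a⁻¹ else if k = j then a else 1)

theorem ta_mul (i j : Fin n) (a b : Fˣ) : ta i j (a * b) = coroot i j a * ta i j b := by
  rw [ta, coroot, ta, dg_mul]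
  congr 1
  ext k : 1
  simp only [Pi.mul_apply]
  split_ifs
  · simp [mul_comm]
  · rfl
  · simp

theorem swap_mul_tv {i j : Fin n} (h : i ≠ j) (a : Fˣ) :
    pm F (Equiv.swap i j) * tv h (a : F) =
      tv h ((a⁻¹ : Fˣ) : F) * ta i j a * tv h.symm ((a⁻¹ : Fˣ) : F) := by
  ext k l
  have ha : (a : F) ≠ 0 := a.ne_zero
  rw [Units.val_mul, pm_mul_apply, tv_apply]
  change _ = (transvection i j _ * diagonal _ * transvection j i _ : Matrix (Fin n) (Fin n) F) k l
  have e1 : ∀ (A : Matrix (Fin n) (Fin n) F) (c : F), (A * transvection j i c) k l =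
      A k l + if l = i then c * A k j else 0 := by
    intro A c
    by_cases hl : l = i
    · subst hl; simp
    · simp [hl]
  have e2 : ∀ (A : Matrix (Fin n) (Fin n) F) (c : F) (m : Fin n), (transvection i j c * A) k m =
      A k m + if k = i then c * A j m else 0 := by
    intro A c m
    by_cases hk : k = i
    · subst hk; simp
    · simp [hk]
  simp only [e1, e2, diagonal_apply, one_apply]
  by_cases hli : l = i <;> by_cases hki : k = i <;> by_cases hlj : l = j <;>
    by_cases hkj : k = j <;> subst_vars <;>
    first
    | exact absurd rfl h
    | simp_all [Equiv.swap_apply_of_ne_of_ne, eq_comm]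

end Elements

section Bruhat

variable {F : Type} [Field F] {n : ℕ} {α : Type} [LinearOrder α]

/-- The block function merging the indices `i` and `j`. -/
def mrg (i j : Fin n) : Fin n → Fin n := fun k => if k = j then i else k

theorem ne_of_adj {i j : Fin n} (h : (i : ℕ) + 1 = j) : i ≠ j := by
  rintro rfl; omega

theorem lt_of_adj {i j : Fin n} (h : (i : ℕ) + 1 = j) : i < j := by
  rw [Fin.lt_def]; omega

theorem lt_of_mrg_lt {i j : Fin n} (h : (i : ℕ) + 1 = j) {k l : Fin n}
    (hkl : mrg i j k < mrg i j l) : k < l := by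
  simp only [mrg] at hkl
  split_ifs at hkl <;> simp only [Fin.lt_def, Fin.ext_iff] at * <;> omega

theorem mrg_le {i j : Fin n} (h : (i : ℕ) + 1 = j) {k l : Fin n}
    (hkl : k < l) : mrg i j k ≤ mrg i j l := by
  by_contra hlt
  exact absurd (lt_of_mrg_lt h (not_le.mp hlt)) (not_lt.mpr hkl.le)

theorem mrg_swap (i j : Fin n) (k : Fin n) : mrg i j (Equiv.swap i j k) = mrg i j k := by
  simp only [mrg, Equiv.swap_apply_def]
  split_ifs <;> simp_all

theorem pm_mem_par {σ : Equiv.Perm (Fin n)} {c : Fin n → α} (h : ∀ k, c (σ k) = c k) :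
    pm F σ ∈ par F c := by
  rw [mem_par]
  intro k l hkl
  rw [pm_apply, if_neg]
  rintro rfl
  rw [h] at hkl
  exact lt_irrefl _ hkl

theorem swap_mem_par (i j : Fin n) : pm F (Equiv.swap i j) ∈ par F (mrg i j) :=
  pm_mem_par (mrg_swap i j)

theorem swap_mem_par_dual (i j : Fin n) :
    pm F (Equiv.swap i j) ∈ par F (OrderDual.toDual ∘ mrg i j) :=
  pm_mem_par (fun k => congrArg OrderDual.toDual (mrg_swap i j k))

theorem mrg_eq (i j : Fin n) : mrg i j i = mrg i j j := by
  simp [mrg]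

theorem eq_of_mrg_eq {i j k l : Fin n} (h : mrg i j k = mrg i j l) (hkl : k ≠ l) :
    (k = i ∧ l = j) ∨ (k = j ∧ l = i) := by
  simp only [mrg] at h
  split_ifs at h <;> simp_all

theorem rad_mrg_le {i j : Fin n} (h : (i : ℕ) + 1 = j) :
    rad F (mrg i j) ≤ rad F (id : Fin n → Fin n) :=
  rad_mono fun _ _ hkl => lt_of_mrg_lt h hkl

theorem rad_mrg_dual_le {i j : Fin n} (h : (i : ℕ) + 1 = j) :
    rad F (OrderDual.toDual ∘ mrg i j) ≤ rad F (OrderDual.toDual : Fin n → (Fin n)ᵒᵈ) :=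
  rad_mono fun _ _ hkl => lt_of_mrg_lt h hkl

theorem exists_upper_split {i j : Fin n} (h : (i : ℕ) + 1 = j) {u : GL (Fin n) F}
    (hu : u ∈ rad F (id : Fin n → Fin n)) :
    ∃ x ∈ rad F (mrg i j), ∃ a : F, u = x * tv (ne_of_adj h) a := by
  obtain ⟨x, hx, m, -, rfl, hm⟩ := exists_rad_mul (b := mrg i j) (fun k l hkl => mrg_le h hkl) hu
  refine ⟨x, hx, (↑(x * m) : Matrix (Fin n) (Fin n) F) i j, ?_⟩
  congr 1
  ext k l
  rw [hm, tv_apply]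
  rw [mem_rad] at hu
  by_cases hkl : k = l
  · subst hkl
    rw [if_pos rfl, hu _ _ (lt_irrefl _), if_neg, add_zero]
    rintro ⟨rfl, rfl⟩; exact ne_of_adj h rfl
  · rw [one_apply_ne hkl]
    by_cases hb : mrg i j k = mrg i j l
    · rw [if_pos hb]
      rcases eq_of_mrg_eq hb hkl with ⟨rfl, rfl⟩ | ⟨rfl, rfl⟩
      · simp
      · rw [if_neg, hu _ _ (not_lt.mpr (lt_of_adj h).le), one_apply_ne hkl, add_zero]
        exact fun hc => hkl hc.2
    · rw [if_neg hb, if_neg, add_zero]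
      rintro ⟨rfl, rfl⟩; exact hb (mrg_eq _ _)

theorem exists_lower_split {i j : Fin n} (h : (i : ℕ) + 1 = j) {u : GL (Fin n) F}
    (hu : u ∈ rad F (OrderDual.toDual : Fin n → (Fin n)ᵒᵈ)) :
    ∃ x ∈ rad F (OrderDual.toDual ∘ mrg i j),
      u = x * tv (ne_of_adj h).symm ((u : Matrix (Fin n) (Fin n) F) j i) := by
  obtain ⟨x, hx, m, -, rfl, hm⟩ := exists_rad_mul (b := OrderDual.toDual ∘ mrg i j)
    (fun k l hkl => mrg_le h (OrderDual.toDual_lt_toDual.mp hkl)) hu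
  refine ⟨x, hx, ?_⟩
  congr 1
  ext k l
  rw [hm, tv_apply]
  rw [mem_rad] at hu
  by_cases hkl : k = l
  · subst hkl
    rw [if_pos rfl, hu _ _ (lt_irrefl _), if_neg, add_zero]
    rintro ⟨rfl, rfl⟩; exact ne_of_adj h rfl
  · rw [one_apply_ne hkl]
    by_cases hb : mrg i j k = mrg i j l
    · rw [if_pos (show (OrderDual.toDual ∘ mrg i j) k = (OrderDual.toDual ∘ mrg i j) l from
        congrArg OrderDual.toDual hb)]
      rcases eq_of_mrg_eq hb hkl with ⟨rfl, rfl⟩ | ⟨rfl, rfl⟩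
      · rw [if_neg, hu _ _ (not_lt.mpr (OrderDual.toDual_le_toDual.mpr (lt_of_adj h).le)),
          one_apply_ne hkl, add_zero]
        exact fun hc => hkl hc.2
      · simp
    · rw [if_neg (show ¬ (OrderDual.toDual ∘ mrg i j) k = (OrderDual.toDual ∘ mrg i j) l from
        fun hc => hb (OrderDual.toDual.injective hc)), if_neg, add_zero]
      rintro ⟨rfl, rfl⟩; exact hb (mrg_eq _ _).symm

/-- A set of matrices containing `1` and stable under left multiplication by upper unipotent
matrices, diagonal matrices and adjacent transpositions is everything. -/
theorem gl_induction (S : Set (GL (Fin n) F)) (h1 : 1 ∈ S)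
    (hU : ∀ u ∈ rad F (id : Fin n → Fin n), ∀ x ∈ S, u * x ∈ S)
    (hT : ∀ t ∈ tor F n, ∀ x ∈ S, t * x ∈ S)
    (hs : ∀ i j : Fin n, (i : ℕ) + 1 = j → ∀ x ∈ S, pm F (Equiv.swap i j) * x ∈ S)
    (g : GL (Fin n) F) : g ∈ S := by
  have hW : ∀ σ : Equiv.Perm (Fin n), ∀ x ∈ S, pm F σ * x ∈ S := by
    intro σ
    induction σ using perm_induction with
    | h1 => intro x hx; simpa using hx
    | hs w i j hij _ ih =>
      intro x hx
      rw [map_mul, mul_assoc]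
      exact ih _ (hs i j hij x hx)
  have hV : ∀ (i j : Fin n) (h : i ≠ j) (a : F), ∀ x ∈ S, tv h a * x ∈ S := by
    intro i j h a x hx
    rcases lt_or_gt_of_ne h with hlt | hlt
    · exact hU _ (tv_mem_rad h a hlt) x hx
    · have e : tv h a = pm F (Equiv.swap i j) * tv h.symm a * (pm F (Equiv.swap i j))⁻¹ := by
        rw [pm_mul_tv, mul_inv_cancel_right]
        congr 1 <;> simp
      rw [e, ← map_inv, mul_assoc, mul_assoc]
      exact hW _ _ (hU _ (tv_mem_rad h.symm a hlt) _ (hW _ _ hx))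
  have key : ∀ x ∈ S, g * x ∈ S := by
    refine diagonal_transvection_induction_of_det_ne_zero
      (fun M => ∀ g : GL (Fin n) F, (g : Matrix (Fin n) (Fin n) F) = M → ∀ x ∈ S, g * x ∈ S)
      (g : Matrix (Fin n) (Fin n) F) g.det.ne_zero ?_ ?_ ?_ g rfl
    · intro D _ g hg x hx
      refine hT g ?_ x hx
      rw [mem_tor]
      intro i j hij
      rw [hg, diagonal_apply_ne _ hij]
    · intro t g hg x hx
      have : g = tv t.hij t.c := by ext : 1; exact hg
      rw [this]
      exact hV _ _ _ _ x hx
    · intro A B hA hB PA PB g hg x hx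
      have : g = GeneralLinearGroup.mkOfDetNeZero A hA * GeneralLinearGroup.mkOfDetNeZero B hB := by
        ext : 1; exact hg
      rw [this, mul_assoc]
      exact PA _ rfl _ (PB _ rfl _ hx)
  simpa using key 1 h1

/-- Conjugating an upper unipotent matrix without `(i, i + 1)` entry. -/
theorem swap_conj_mem {i j : Fin n} {x : GL (Fin n) F} (hx : x ∈ rad F (mrg i j)) :
    pm F (Equiv.swap i j) * x * (pm F (Equiv.swap i j))⁻¹ ∈ rad F (mrg i j) :=
  conj_mem_rad (swap_mem_par i j) hx

theorem exists_bruhat (g : GL (Fin n) F) :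
    ∃ u ∈ rad F (id : Fin n → Fin n), ∃ σ : Equiv.Perm (Fin n),
      ∃ y ∈ par F (OrderDual.toDual : Fin n → (Fin n)ᵒᵈ), g = u * pm F σ * y := by
  refine gl_induction {g | ∃ u ∈ rad F (id : Fin n → Fin n), ∃ σ : Equiv.Perm (Fin n),
      ∃ y ∈ par F (OrderDual.toDual : Fin n → (Fin n)ᵒᵈ), g = u * pm F σ * y} ?_ ?_ ?_ ?_ g
  · exact ⟨1, one_mem _, 1, 1, one_mem _, by simp⟩
  · rintro u hu _ ⟨u', hu', σ, y, hy, rfl⟩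
    exact ⟨u * u', mul_mem hu hu', σ, y, hy, by group⟩
  · rintro t ht _ ⟨u', hu', σ, y, hy, rfl⟩
    have h1 := pm_conj_mem_tor σ⁻¹ ht
    refine ⟨t * u' * t⁻¹, conj_mem_rad (tor_le_par _ ht) hu', σ,
      (pm F σ⁻¹ * t * (pm F σ⁻¹)⁻¹) * y, mul_mem (tor_le_par _ h1) hy, ?_⟩
    rw [map_inv]; group
  · rintro i j hij _ ⟨u, hu, σ, y, hy, rfl⟩
    obtain ⟨x, hx, a, rfl⟩ := exists_upper_split hij hu
    have hne := ne_of_adj hij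
    have hx' := rad_mrg_le hij (swap_conj_mem (i := i) (j := j) hx)
    have conjtv : ∀ {k l : Fin n} (h : k ≠ l) (c : F), tv h c * pm F σ =
        pm F σ * tv (σ⁻¹.injective.ne h) c := by
      intro k l h c
      rw [pm_mul_tv]
      congr 2 <;> simp
    rcases lt_or_gt_of_ne (σ⁻¹.injective.ne hne) with hlt | hlt
    · by_cases ha : a = 0
      · subst ha
        refine ⟨_, hx', Equiv.swap i j * σ, y, hy, ?_⟩
        rw [tv_zero, map_mul]; group
      · have e := swap_mul_tv hne (Units.mk0 a ha)
        rw [Units.val_mk0] at e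
        set c : F := (((Units.mk0 a ha)⁻¹ : Fˣ) : F)
        set t := ta i j (Units.mk0 a ha) with ht
        have htor : t ∈ tor F n := dg_mem_tor _
        have h1 := pm_conj_mem_tor σ⁻¹ htor
        refine ⟨_, mul_mem hx' (tv_mem_rad hne c (lt_of_adj hij)), σ,
          (pm F σ⁻¹ * t * (pm F σ⁻¹)⁻¹) * tv (σ⁻¹.injective.ne hne.symm) c * y,
          mul_mem (mul_mem (tor_le_par _ h1) (tv_mem_par _ _ ?_)) hy, ?_⟩
        · exact OrderDual.toDual_le_toDual.mpr hlt.le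
        · calc pm F (Equiv.swap i j) * (x * tv hne a * pm F σ * y)
              = (pm F (Equiv.swap i j) * x * (pm F (Equiv.swap i j))⁻¹) *
                (pm F (Equiv.swap i j) * tv hne a) * pm F σ * y := by group
            _ = (pm F (Equiv.swap i j) * x * (pm F (Equiv.swap i j))⁻¹) *
                tv hne c * t * (tv hne.symm c * pm F σ) * y := by rw [e]; group
            _ = _ := by rw [conjtv, map_inv]; group
    · refine ⟨_, hx', Equiv.swap i j * σ, tv (σ⁻¹.injective.ne hne) a * y,
        mul_mem (tv_mem_par _ _ ?_) hy, ?_⟩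
      · exact OrderDual.toDual_le_toDual.mpr hlt.le
      · calc pm F (Equiv.swap i j) * (x * tv hne a * pm F σ * y)
              = (pm F (Equiv.swap i j) * x * (pm F (Equiv.swap i j))⁻¹) *
                pm F (Equiv.swap i j) * (tv hne a * pm F σ) * y := by group
            _ = _ := by rw [conjtv, map_mul]; group

end Bruhat

section Rep

variable {G : Type} [Group G] {C : Type} [Field C] {V : Type} [AddCommGroup V] [Module C V]
  (ρ : Representation C G V)

/-- Vectors fixed by a subgroup. -/
def fix (H : Subgroup G) : Submodule C V where
  carrier := {v | ∀ g ∈ H, ρ g v = v}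
  add_mem' := by intro v w hv hw g hg; rw [map_add, hv g hg, hw g hg]
  zero_mem' := by intro g hg; rw [map_zero]
  smul_mem' := by intro c v hv g hg; rw [_root_.map_smul, hv g hg]

/-- The kernel of the projection to the coinvariants of a subgroup. -/
def aug (H : Subgroup G) : Submodule C V :=
  Submodule.span C {x | ∃ g ∈ H, ∃ v : V, x = ρ g v - v}

variable {ρ}

theorem sub_mem_aug {H : Subgroup G} {g : G} (hg : g ∈ H) (v : V) : ρ g v - v ∈ aug ρ H :=
  Submodule.subset_span ⟨g, hg, v, rfl⟩

theorem aug_le {H : Subgroup G} {W : Submodule C V} (h : ∀ g ∈ H, ∀ v, ρ g v - v ∈ W) :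
    aug ρ H ≤ W := by
  refine Submodule.span_le.mpr ?_
  rintro _ ⟨g, hg, v, rfl⟩
  exact h g hg v

theorem aug_mono {H H' : Subgroup G} (h : H ≤ H') : aug ρ H ≤ aug ρ H' :=
  aug_le fun _ hg v => sub_mem_aug (h hg) v

theorem fix_mono {H H' : Subgroup G} (h : H ≤ H') : fix ρ H' ≤ fix ρ H :=
  fun _ hv g hg => hv g (h hg)

theorem rho_mul (g h : G) (v : V) : ρ g (ρ h v) = ρ (g * h) v := by
  rw [map_mul]; rfl

theorem rho_inv_self (g : G) (v : V) : ρ g⁻¹ (ρ g v) = v := by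
  rw [rho_mul]; simp

theorem rho_ne_zero (g : G) {v : V} (hv : v ≠ 0) : ρ g v ≠ 0 := by
  intro h
  apply hv
  rw [← rho_inv_self (ρ := ρ) g v, h, map_zero]

theorem rho_mem_fix {H : Subgroup G} {g : G} (hg : ∀ h ∈ H, g⁻¹ * h * g ∈ H) {v : V}
    (hv : v ∈ fix ρ H) : ρ g v ∈ fix ρ H := by
  intro h hh
  have := hv _ (hg h hh)
  have e : h * g = g * (g⁻¹ * h * g) := by group
  rw [rho_mul, e, ← rho_mul, this]

theorem rho_mem_aug {H H' : Subgroup G} {g : G} (hg : ∀ h ∈ H, g * h * g⁻¹ ∈ H') {v : V}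
    (hv : v ∈ aug ρ H) : ρ g v ∈ aug ρ H' := by
  have : aug ρ H ≤ (aug ρ H').comap (ρ g) := by
    refine aug_le fun h hh v => ?_
    rw [Submodule.mem_comap, map_sub]
    have := sub_mem_aug (ρ := ρ) (hg h hh) (ρ g v)
    rw [rho_mul] at this
    rw [rho_mul]
    simpa using this
  exact this hv

theorem rho_mem_aug_self {H : Subgroup G} {g : G} (hg : g ∈ H) {v : V} :
    ρ g v ∈ aug ρ H ↔ v ∈ aug ρ H := by
  have := sub_mem_aug (ρ := ρ) hg v
  constructor
  · intro h
    simpa using Submodule.sub_mem _ h this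
  · intro h
    simpa using Submodule.add_mem _ this h

/-- A `p`-group acting in characteristic `p` has nonzero fixed vectors. -/
theorem exists_fixed (p : ℕ) [Fact p.Prime] [CharP C p] {H : Subgroup G} [Finite H]
    (hH : IsPGroup p H) {K : Submodule C V} (hK : K ≠ ⊥) (hst : ∀ g ∈ H, ∀ v ∈ K, ρ g v ∈ K) :
    ∃ v ∈ K, v ≠ 0 ∧ v ∈ fix ρ H := by
  obtain ⟨v, hvK, hv⟩ := (Submodule.ne_bot_iff K).mp hK
  have hpV : ∀ w : V, p • w = 0 := by
    intro w
    rw [← Nat.cast_smul_eq_nsmul C, CharP.cast_eq_zero, zero_smul]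
  let A : AddSubgroup V := AddSubgroup.closure (Set.range fun h : H => ρ (h : G) v)
  have hAst : ∀ h : H, ∀ a ∈ A, ρ (h : G) a ∈ A := by
    intro h a ha
    induction ha using AddSubgroup.closure_induction with
    | mem x hx =>
      obtain ⟨k, rfl⟩ := hx
      refine AddSubgroup.subset_closure ⟨h * k, ?_⟩
      simp
    | zero => rw [map_zero]; exact A.zero_mem
    | add x y _ _ hx hy => rw [map_add]; exact A.add_mem hx hy
    | neg x _ hx => rw [map_neg]; exact A.neg_mem hx
  have hAK : ∀ a ∈ A, a ∈ K := by
    intro a ha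
    have : A ≤ K.toAddSubgroup := by
      rw [AddSubgroup.closure_le]
      rintro _ ⟨h, rfl⟩
      exact hst _ h.2 _ hvK
    exact this ha
  have hvA : v ∈ A := AddSubgroup.subset_closure ⟨1, by simp⟩
  have : AddGroup.FG A := by
    rw [AddGroup.fg_iff_addSubgroup_fg]
    exact (AddSubgroup.fg_iff A).mpr ⟨_, rfl, Set.finite_range _⟩
  have hp0 : 0 < p := (Fact.out : p.Prime).pos
  have : Finite A := by
    refine AddCommGroup.finite_of_fg_isAddTorsion A ?_
    intro a
    rw [isOfFinAddOrder_iff_nsmul_eq_zero]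
    exact ⟨p, hp0, Subtype.ext (by simpa using hpV a)⟩
  let act : MulAction H A :=
    { smul := fun h a => ⟨ρ (h : G) a, hAst h a a.2⟩
      one_smul := fun a => Subtype.ext (by change ρ ((1 : H) : G) (a : V) = a; simp)
      mul_smul := fun h k a => Subtype.ext (by
        change ρ ((h * k : H) : G) (a : V) = ρ (h : G) (ρ (k : G) a)
        simp) }
  have hdvd : p ∣ Nat.card A := by
    have h1 : addOrderOf (⟨v, hvA⟩ : A) = p := by
      refine addOrderOf_eq_prime (Subtype.ext (by simpa using hpV v)) ?_
      intro h
      exact hv (congrArg Subtype.val h)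
    rw [← h1]
    exact addOrderOf_dvd_natCard _
  obtain ⟨b, hb, hb0⟩ := hH.exists_fixed_point_of_prime_dvd_card_of_fixed_point A hdvd
    (a := 0) (fun h => Subtype.ext (by change ρ (h : G) (0 : V) = 0; simp))
  refine ⟨b, hAK _ b.2, fun h => hb0 (Subtype.ext h.symm), ?_⟩
  intro g hg
  exact congrArg Subtype.val (hb ⟨g, hg⟩)

theorem aug_ne_top (p : ℕ) [Fact p.Prime] [CharP C p] {H : Subgroup G} [Finite H]
    (hH : IsPGroup p H) [Nontrivial V] : aug ρ H ≠ ⊤ := by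
  intro htop
  have hne : (⊤ : Submodule C (Module.Dual C V)) ≠ ⊥ := top_ne_bot
  obtain ⟨f, -, hf0, hf⟩ := exists_fixed (ρ := ρ.dual) p hH hne (fun _ _ _ _ => trivial)
  apply hf0
  have : aug ρ H ≤ LinearMap.ker f := by
    refine aug_le fun g hg v => ?_
    have h1 := LinearMap.congr_fun (hf g⁻¹ (H.inv_mem hg)) v
    simp only [Representation.dual_apply, inv_inv, Module.Dual.transpose_apply] at h1
    rw [LinearMap.mem_ker, map_sub, sub_eq_zero]
    exact h1
  rw [htop, top_le_iff, LinearMap.ker_eq_top] at this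
  exact this

/-- Simultaneous eigenvectors for a commutative subgroup. -/
theorem exists_common_eigenvector [IsAlgClosed C] [FiniteDimensional C V] {T : Subgroup G}
    (hT : ∀ s ∈ T, ∀ t ∈ T, s * t = t * s) (K : Submodule C V) (hK : K ≠ ⊥)
    (hst : ∀ t ∈ T, ∀ v ∈ K, ρ t v ∈ K) :
    ∃ v ∈ K, v ≠ 0 ∧ ∀ t ∈ T, ∃ c : C, ρ t v = c • v := by
  induction K using WellFoundedLT.induction with
  | ind K ih =>
    by_cases hsc : ∀ t ∈ T, ∃ c : C, ∀ v ∈ K, ρ t v = c • v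
    · obtain ⟨v, hvK, hv⟩ := (Submodule.ne_bot_iff K).mp hK
      refine ⟨v, hvK, hv, fun t ht => ?_⟩
      obtain ⟨c, hc⟩ := hsc t ht
      exact ⟨c, hc v hvK⟩
    · push Not at hsc
      obtain ⟨t, ht, hsc⟩ := hsc
      have : Nontrivial K := Submodule.nontrivial_iff_ne_bot.mpr hK
      obtain ⟨μ, hμ⟩ := Module.End.exists_eigenvalue ((ρ t).restrict (hst t ht))
      obtain ⟨w, hw⟩ := hμ.exists_hasEigenvector
      have hw1 : ρ t (w : V) = μ • (w : V) := congrArg Subtype.val hw.apply_eq_smul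
      have hw0 : (w : V) ≠ 0 := fun h => hw.2 (Subtype.ext h)
      obtain ⟨v, ⟨hvK, -⟩, hv⟩ := ih (K ⊓ LinearMap.ker (ρ t - μ • LinearMap.id))
        (lt_of_le_of_ne inf_le_left (fun h => by
          obtain ⟨x, hx, hxn⟩ := hsc μ
          have : x ∈ K ⊓ LinearMap.ker (ρ t - μ • LinearMap.id) := by rw [h]; exact hx
          have h2 := (Submodule.mem_inf.mp this).2
          rw [LinearMap.mem_ker, LinearMap.sub_apply, sub_eq_zero] at h2
          exact hxn (by simpa using h2)))
        ((Submodule.ne_bot_iff _).mpr ⟨w, ⟨w.2, by simp [hw1]⟩, hw0⟩)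
        (by
          rintro s hs x ⟨hxK, hx⟩
          refine ⟨hst s hs x hxK, ?_⟩
          rw [SetLike.mem_coe] at hx ⊢
          rw [LinearMap.mem_ker, LinearMap.sub_apply, sub_eq_zero] at hx ⊢
          simp only [LinearMap.smul_apply, LinearMap.id_apply] at hx ⊢
          rw [rho_mul, hT t ht s hs, ← rho_mul, hx, map_smul])
      exact ⟨v, hvK, hv⟩

theorem finiteDimensional_of_irreducible [Finite G] [Nontrivial V]
    (hirr : ∀ S : Submodule C V, (∀ (g : G) (v : V), v ∈ S → ρ g v ∈ S) → S = ⊥ ∨ S = ⊤) :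
    FiniteDimensional C V := by
  obtain ⟨v, hv⟩ := exists_ne (0 : V)
  have hmem : v ∈ Submodule.span C (Set.range fun g : G => ρ g v) :=
    Submodule.subset_span ⟨1, by simp⟩
  rcases hirr (Submodule.span C (Set.range fun g : G => ρ g v)) (by
    intro g x hx
    induction hx using Submodule.span_induction with
    | mem x hx =>
      obtain ⟨h, rfl⟩ := hx
      exact Submodule.subset_span ⟨g * h, by simp⟩
    | zero => rw [map_zero]; exact Submodule.zero_mem _
    | add x y _ _ hx hy => rw [map_add]; exact Submodule.add_mem _ hx hy
    | smul c x _ hx => rw [map_smul]; exact Submodule.smul_mem _ _ hx) with h | h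
  · rw [h, Submodule.mem_bot] at hmem
    exact absurd hmem hv
  · exact ⟨h ▸ Submodule.fg_span (Set.finite_range _)⟩

end Rep

section Hecke

variable {F : Type} [Field F] {n : ℕ}

/-- The subgroup of upper unitriangular matrices. -/
abbrev up (F : Type) [Field F] (n : ℕ) : Subgroup (GL (Fin n) F) := rad F (id : Fin n → Fin n)

/-- The subgroup of lower unitriangular matrices. -/
abbrev lo (F : Type) [Field F] (n : ℕ) : Subgroup (GL (Fin n) F) :=
  rad F (OrderDual.toDual : Fin n → (Fin n)ᵒᵈ)

theorem tv_congr {i j k l : Fin n} (h : i ≠ j) (h' : k ≠ l) (hi : i = k) (hj : j = l) (a : F) :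
    tv h a = tv h' a := by
  subst hi; subst hj; rfl

theorem swap_tv {i j : Fin n} (h : i ≠ j) (a : F) :
    pm F (Equiv.swap i j) * tv h a = tv h.symm a * pm F (Equiv.swap i j) := by
  rw [pm_mul_tv]
  congr 1
  exact tv_congr _ _ (Equiv.swap_apply_left _ _) (Equiv.swap_apply_right _ _) a

theorem swap_mul_self (i j : Fin n) :
    pm F (Equiv.swap i j) * pm F (Equiv.swap i j) = 1 := by
  rw [← map_mul, Equiv.swap_mul_self, map_one]

theorem swap_inv (i j : Fin n) : (pm F (Equiv.swap i j))⁻¹ = pm F (Equiv.swap i j) := by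
  rw [← map_inv, Equiv.swap_inv]

theorem conj_inv_mem_rad {α : Type} [LinearOrder α] {c : Fin n → α} {g h : GL (Fin n) F}
    (hg : g ∈ par F c) (hh : h ∈ rad F c) : g⁻¹ * h * g ∈ rad F c := by
  simpa using conj_mem_rad ((par F c).inv_mem hg) hh

theorem tv_mem_up {i j : Fin n} (h : (i : ℕ) + 1 = j) (a : F) : tv (ne_of_adj h) a ∈ up F n :=
  tv_mem_rad _ _ (lt_of_adj h)

theorem tv_mem_lo {i j : Fin n} (h : (i : ℕ) + 1 = j) (a : F) :
    tv (ne_of_adj h).symm a ∈ lo F n :=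
  tv_mem_rad _ _ (lt_of_adj h)

theorem up_inf_lo {u : GL (Fin n) F} (hu : u ∈ up F n) (hl : u ∈ lo F n) : u = 1 := by
  rw [mem_rad] at hu hl
  ext i j
  by_cases h : i < j
  · exact hl i j (fun h' => lt_asymm h h')
  · exact hu i j h

variable [Fintype F] {C : Type} [Field C] {V : Type} [AddCommGroup V] [Module C V]
  (ρ : Representation C (GL (Fin n) F) V)

/-- The Hecke operator of an adjacent transposition. -/
def hecke {i j : Fin n} (h : i ≠ j) : V →ₗ[C] V :=
  ∑ a : F, ρ (pm F (Equiv.swap i j) * tv h a)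

variable {ρ}

theorem hecke_apply {i j : Fin n} (h : i ≠ j) (v : V) :
    hecke ρ h v = ∑ a : F, ρ (pm F (Equiv.swap i j) * tv h a) v := by
  simp only [hecke, LinearMap.sum_apply]

theorem hecke_mem_fix {i j : Fin n} (h : (i : ℕ) + 1 = j) {v : V} (hv : v ∈ fix ρ (lo F n)) :
    hecke ρ (ne_of_adj h) v ∈ fix ρ (lo F n) := by
  intro u hu
  obtain ⟨x, hx, e⟩ := exists_lower_split h hu
  set c := (u : Matrix (Fin n) (Fin n) F) j i
  rw [hecke_apply, map_sum, ← Equiv.sum_comp (Equiv.addLeft c)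
    (fun a => ρ (pm F (Equiv.swap i j) * tv (ne_of_adj h) a) v)]
  refine Finset.sum_congr rfl fun a _ => ?_
  set y := pm F (Equiv.swap i j) * tv (ne_of_adj h) (c + a) with hy
  have hyp : y ∈ par F (OrderDual.toDual ∘ mrg i j) :=
    Subgroup.mul_mem _ (swap_mem_par_dual i j) (tv_mem_par _ _
      (by simp [mrg_eq i j]))
  have e2 : u * (pm F (Equiv.swap i j) * tv (ne_of_adj h) a) = y * (y⁻¹ * x * y) := by
    have : y = tv (ne_of_adj h).symm c * (pm F (Equiv.swap i j) * tv (ne_of_adj h) a) := by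
      rw [← mul_assoc, ← swap_tv, mul_assoc, tv_mul]
    rw [e, mul_assoc, ← this]
    group
  rw [rho_mul, e2, ← rho_mul, hv _ (rad_mrg_dual_le h (conj_inv_mem_rad hyp hx))]
  rfl

theorem hecke_eigen {i j : Fin n} (h : i ≠ j) {v : V}
    (hv : ∀ t ∈ tor F n, ∃ c : C, ρ t v = c • v) :
    ∀ t ∈ tor F n, ∃ c : C, ρ t (hecke ρ h v) = c • hecke ρ h v := by
  intro t ht
  set s := pm F (Equiv.swap i j) with hs
  have ht' : s * t * s⁻¹ ∈ tor F n := pm_conj_mem_tor _ ht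
  set t' := s * t * s⁻¹ with ht'e
  obtain ⟨c, hc⟩ := hv t' ht'
  refine ⟨c, ?_⟩
  have hi := tor_ne_zero ht' i
  have hj := tor_ne_zero ht' j
  set x := (t' : Matrix (Fin n) (Fin n) F) i i
  set y := (t' : Matrix (Fin n) (Fin n) F) j j
  have hss : s⁻¹ = s := swap_inv i j
  rw [hecke_apply, map_sum, ← ((Equiv.mulLeft₀ x hi).trans
    (Equiv.mulRight₀ y⁻¹ (inv_ne_zero hj))).sum_comp (fun a => ρ (_ * tv _ a) v), Finset.smul_sum]
  refine Finset.sum_congr rfl fun a _ => ?_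
  have e : t * (s * tv h a) = s * tv h (x * a * y⁻¹) * t' := by
    rw [mul_assoc s, ← tor_mul_tv ht', ht'e]
    have : s * s = 1 := swap_mul_self i j
    rw [hss]
    simp only [← mul_assoc, this, one_mul]
  rw [rho_mul, e, ← rho_mul, hc, map_smul]
  rfl

theorem hecke_tv {i j : Fin n} (h : i ≠ j) (c : F) (v : V) :
    hecke ρ h (ρ (tv h c) v) = hecke ρ h v := by
  rw [hecke_apply, hecke_apply, ← Equiv.sum_comp (Equiv.addRight c)
    (fun a => ρ (pm F (Equiv.swap i j) * tv h a) v)]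
  refine Finset.sum_congr rfl fun a _ => ?_
  rw [rho_mul, mul_assoc, tv_mul]
  rfl

theorem hecke_swap {i j : Fin n} (h : (i : ℕ) + 1 = j) (hF : (Fintype.card F : C) = 0) {v : V}
    (hv : v ∈ fix ρ (lo F n)) :
    hecke ρ (ne_of_adj h) (ρ (pm F (Equiv.swap i j)) v) = 0 := by
  have : ∀ a : F, ρ (pm F (Equiv.swap i j) * tv (ne_of_adj h) a) (ρ (pm F (Equiv.swap i j)) v)
      = v := by
    intro a
    rw [rho_mul, swap_tv, mul_assoc, swap_mul_self, mul_one, hv _ (tv_mem_lo h a)]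
  rw [hecke_apply, Finset.sum_congr rfl (fun a _ => this a), Finset.sum_const, Finset.card_univ,
    ← Nat.cast_smul_eq_nsmul C, hF, zero_smul]

omit [Fintype F] in
theorem rho_swap_tv {i j : Fin n} (h : (i : ℕ) + 1 = j) {v : V} (hv : v ∈ fix ρ (lo F n))
    (a : Fˣ) {c : C} (hc : ρ (ta i j a) v = c • v) :
    ρ (pm F (Equiv.swap i j) * tv (ne_of_adj h) (a : F)) v =
      c • ρ (tv (ne_of_adj h) ((a⁻¹ : Fˣ) : F)) v := by
  rw [swap_mul_tv, ← rho_mul, hv _ (tv_mem_lo h _), ← rho_mul, hc, map_smul]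

theorem sum_eq_add_sum_units [DecidableEq F] {A : Type} [AddCommMonoid A] (f : F → A) :
    ∑ a : F, f a = f 0 + ∑ a : Fˣ, f a := by
  rw [← Finset.add_sum_erase _ f (Finset.mem_univ 0)]
  congr 1
  refine (Finset.sum_bij (fun (a : Fˣ) _ => (a : F)) ?_ ?_ ?_ ?_).symm
  · intro a _; simp
  · intro a _ b _ h; exact Units.ext h
  · intro b hb
    exact ⟨Units.mk0 b (Finset.ne_of_mem_erase hb), Finset.mem_univ _, rfl⟩
  · intro a _; rfl

theorem hecke_eq [DecidableEq F] {i j : Fin n} (h : (i : ℕ) + 1 = j) {v : V}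
    (hv : v ∈ fix ρ (lo F n)) {χ : Fˣ → C} (hχ : ∀ a, ρ (ta i j a) v = χ a • v) :
    hecke ρ (ne_of_adj h) v = ρ (pm F (Equiv.swap i j)) v +
      ∑ a : Fˣ, χ a • ρ (tv (ne_of_adj h) ((a⁻¹ : Fˣ) : F)) v := by
  rw [hecke_apply, sum_eq_add_sum_units, tv_zero, mul_one]
  congr 1
  exact Finset.sum_congr rfl fun a _ => rho_swap_tv h hv a (hχ a)

theorem hecke_hecke [DecidableEq F] {i j : Fin n} (h : (i : ℕ) + 1 = j)
    (hF : (Fintype.card F : C) = 0) {v : V}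
    (hv : v ∈ fix ρ (lo F n)) {χ : Fˣ → C} (hχ : ∀ a, ρ (ta i j a) v = χ a • v) :
    hecke ρ (ne_of_adj h) (hecke ρ (ne_of_adj h) v) =
      (∑ a : Fˣ, χ a) • hecke ρ (ne_of_adj h) v := by
  conv_lhs => rw [hecke_eq h hv hχ]
  rw [map_add, hecke_swap h hF hv, zero_add, map_sum, Finset.sum_smul]
  refine Finset.sum_congr rfl fun a _ => ?_
  rw [map_smul, hecke_tv]

theorem hecke_mem_aug {i j : Fin n} (h : (i : ℕ) + 1 = j) {v : V} (hv : v ∈ aug ρ (up F n)) :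
    hecke ρ (ne_of_adj h) v ∈ aug ρ (up F n) := by
  suffices aug ρ (up F n) ≤ (aug ρ (up F n)).comap (hecke ρ (ne_of_adj h)) from this hv
  refine aug_le fun u hu w => ?_
  obtain ⟨x, hx, a, rfl⟩ := exists_upper_split h hu
  rw [Submodule.mem_comap, map_sub, ← hecke_tv (ρ := ρ) (ne_of_adj h) a w, ← rho_mul]
  generalize ρ (tv (ne_of_adj h) a) w = w
  rw [hecke_apply, hecke_apply, ← Finset.sum_sub_distrib]
  refine Submodule.sum_mem _ fun b _ => ?_
  set y := pm F (Equiv.swap i j) * tv (ne_of_adj h) b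
  have hyp : y ∈ par F (mrg i j) :=
    Subgroup.mul_mem _ (swap_mem_par i j) (tv_mem_par _ _ (mrg_eq i j).le)
  have e : y * x = y * x * y⁻¹ * y := by group
  rw [rho_mul, e, ← rho_mul]
  exact sub_mem_aug (rad_mrg_le h (conj_mem_rad hyp hx)) _

variable (ρ) in
open Classical in
/-- The Hecke operator of a permutation. -/
noncomputable def heckeW [Fintype (GL (Fin n) F)] (σ : Equiv.Perm (Fin n)) : V →ₗ[C] V :=
  ∑ u ∈ Finset.univ.filter (fun u => u ∈ lo F n ⊓ rad F (σ : Fin n → Fin n)), ρ (u * (pm F σ)⁻¹)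

omit [Fintype F] in
theorem heckeW_one [Fintype (GL (Fin n) F)] (v : V) :
    heckeW ρ (1 : Equiv.Perm (Fin n)) v = v := by
  have : ∀ u : GL (Fin n) F, u ∈ lo F n ⊓ rad F ((1 : Equiv.Perm (Fin n)) : Fin n → Fin n) ↔
      u = 1 := by
    intro u
    constructor
    · rintro ⟨h1, h2⟩
      exact up_inf_lo h2 h1
    · rintro rfl
      exact Subgroup.one_mem _
  classical
  rw [heckeW, Finset.filter_congr (fun u _ => this u)]
  simp [Finset.filter_eq']

theorem heckeW_mul_swap [Fintype (GL (Fin n) F)] (σ : Equiv.Perm (Fin n)) {i j : Fin n}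
    (h : (i : ℕ) + 1 = j) (hσ : σ i < σ j) (v : V) :
    heckeW ρ (σ * Equiv.swap i j) v = hecke ρ (ne_of_adj h) (heckeW ρ σ v) := by
  classical
  set s := pm F (Equiv.swap i j) with hs
  have hss : s * s = 1 := swap_mul_self i j
  have hsi : s⁻¹ = s := swap_inv i j
  have hsp : s ∈ par F (OrderDual.toDual ∘ mrg i j) := swap_mem_par_dual i j
  have hrad : ∀ u : GL (Fin n) F, s * u * s ∈ rad F ((σ * Equiv.swap i j : Equiv.Perm (Fin n)) :
      Fin n → Fin n) ↔ u ∈ rad F (σ : Fin n → Fin n) := by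
    intro u
    have := pm_conj_mem_rad (F := F) (Equiv.swap i j)
      (c := ((σ * Equiv.swap i j : Equiv.Perm (Fin n)) : Fin n → Fin n)) (g := u)
    rw [← hs, hsi] at this
    rw [this]
    have e : ((σ * Equiv.swap i j : Equiv.Perm (Fin n)) : Fin n → Fin n) ∘ (Equiv.swap i j) =
      (σ : Fin n → Fin n) := by
      ext k; simp
    rw [e]
  have hsplit : ∀ u ∈ lo F n ⊓ rad F (σ : Fin n → Fin n),
      s * u * s ∈ rad F (OrderDual.toDual ∘ mrg i j) := by
    rintro u ⟨hu, hu'⟩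
    obtain ⟨x, hx, e⟩ := exists_lower_split h hu
    have h0 : (u : Matrix (Fin n) (Fin n) F) j i = 0 := by
      have := mem_rad.mp hu' j i (not_lt.mpr hσ.le)
      rw [this, one_apply_ne (ne_of_adj h).symm]
    rw [h0, tv_zero, mul_one] at e
    subst e
    have := conj_mem_rad hsp hx
    rwa [hsi] at this
  have htv : ∀ a : F, tv (ne_of_adj h).symm a ∈ rad F ((σ * Equiv.swap i j :
      Equiv.Perm (Fin n)) : Fin n → Fin n) := fun a => tv_mem_rad _ _ (by simpa using hσ)
  rw [hecke_apply]
  simp only [heckeW, LinearMap.sum_apply, map_sum]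
  rw [← Finset.sum_product']
  symm
  refine Finset.sum_bij' (fun (p : F × GL (Fin n) F) _ => tv (ne_of_adj h).symm p.1 * (s * p.2 * s))
    (fun z _ => ((z : Matrix (Fin n) (Fin n) F) j i,
      s * (tv (ne_of_adj h).symm (-(z : Matrix (Fin n) (Fin n) F) j i) * z) * s)) ?_ ?_ ?_ ?_ ?_
  · rintro ⟨a, u⟩ hu
    simp only [Finset.mem_product, Finset.mem_univ, Finset.mem_filter, true_and] at hu ⊢
    exact ⟨Subgroup.mul_mem _ (tv_mem_lo h a) (rad_mrg_dual_le h (hsplit u hu)),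
      Subgroup.mul_mem _ (htv a) ((hrad u).mpr hu.2)⟩
  · intro z hz
    simp only [Finset.mem_product, Finset.mem_univ, Finset.mem_filter, true_and] at hz ⊢
    obtain ⟨x, hx, e⟩ := exists_lower_split h hz.1
    set c := (z : Matrix (Fin n) (Fin n) F) j i
    constructor
    · refine rad_mrg_dual_le h ?_
      have hy : tv (ne_of_adj h).symm (-c) * z ∈ rad F (OrderDual.toDual ∘ mrg i j) := by
        have hp : tv (ne_of_adj h).symm (-c) ∈ par F (OrderDual.toDual ∘ mrg i j) :=
          tv_mem_par _ _ (by simp [mrg_eq i j])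
        have hi : (tv (ne_of_adj h).symm (-c))⁻¹ = tv (ne_of_adj h).symm c := by
          rw [inv_eq_iff_mul_eq_one, tv_mul, neg_add_cancel, tv_zero]
        have := conj_mem_rad hp hx
        rwa [hi, mul_assoc, ← e] at this
      have := conj_mem_rad hsp hy
      rwa [hsi] at this
    · change _ ∈ rad F (σ : Fin n → Fin n)
      rw [← hrad]
      have e : ∀ y, s * (s * y * s) * s = y := by
        intro y
        simp only [mul_assoc, hss, mul_one]
        simp only [← mul_assoc, hss, one_mul]
      rw [e]
      exact Subgroup.mul_mem _ (htv _) hz.2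
  · rintro ⟨a, u⟩ hu
    simp only [Finset.mem_product, Finset.mem_univ, Finset.mem_filter, true_and] at hu
    have hy := mem_rad.mp (hsplit u hu)
    have e1 : (↑(tv (ne_of_adj h).symm a * (s * u * s)) : Matrix (Fin n) (Fin n) F) j i = a := by
      rw [Units.val_mul]
      change (transvection j i a * (↑(s * u * s) : Matrix (Fin n) (Fin n) F)) j i = a
      rw [transvection_mul_apply_same, hy j i (by simp [mrg_eq i j]), hy i i (lt_irrefl _),
        one_apply_ne (ne_of_adj h).symm, one_apply_eq]
      simp
    refine Prod.ext e1 ?_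
    simp only [e1]
    rw [← mul_assoc (tv _ _) (tv _ _), tv_mul, neg_add_cancel, tv_zero, one_mul]
    simp only [mul_assoc, hss, mul_one]
    simp only [← mul_assoc, hss, one_mul]
  · intro z hz
    have : ∀ y, s * (s * y * s) * s = y := by
      intro y
      simp only [mul_assoc, hss, mul_one]
      simp only [← mul_assoc, hss, one_mul]
    simp only [this]
    rw [← mul_assoc, tv_mul, add_neg_cancel, tv_zero, one_mul]
  · rintro ⟨a, u⟩ hu
    simp only
    rw [rho_mul, swap_tv, map_mul (pm F), _root_.mul_inv_rev, ← hs, hsi]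
    congr 2
    simp only [mul_assoc]
    rw [← mul_assoc s s, hss, one_mul]

theorem exists_hecke_eigenvector [IsAlgClosed C] [FiniteDimensional C V]
    (hF : (Fintype.card F : C) = 0) {K : Submodule C V} (hK : K ≠ ⊥)
    (hKlo : K ≤ fix ρ (lo F n)) (hKT : ∀ t ∈ tor F n, ∀ v ∈ K, ρ t v ∈ K)
    (hKY : ∀ (i j : Fin n) (h : (i : ℕ) + 1 = j), ∀ v ∈ K, hecke ρ (ne_of_adj h) v ∈ K) :
    ∃ v ∈ K, v ≠ 0 ∧ (∀ t ∈ tor F n, ∃ c : C, ρ t v = c • v) ∧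
      ∀ (i j : Fin n) (h : (i : ℕ) + 1 = j), ∃ c : C, hecke ρ (ne_of_adj h) v = c • v := by
  classical
  have : Fintype (GL (Fin n) F) := Fintype.ofFinite _
  obtain ⟨v, hvK, hv0, hvT⟩ :=
    exists_common_eigenvector (fun _ hs _ ht => tor_mul_comm hs ht) K hK hKT
  have key : ∀ σ : Equiv.Perm (Fin n), heckeW ρ σ v ∈ K ∧
      ∀ t ∈ tor F n, ∃ c : C, ρ t (heckeW ρ σ v) = c • heckeW ρ σ v := by
    intro σ
    induction σ using perm_induction with
    | h1 => rw [heckeW_one]; exact ⟨hvK, hvT⟩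
    | hs w i j h hw ih =>
      rw [heckeW_mul_swap w h hw]
      exact ⟨hKY i j h _ ih.1, hecke_eigen _ ih.2⟩
  obtain ⟨σ, hσ, hmin⟩ := Set.exists_min_image {σ : Equiv.Perm (Fin n) | heckeW ρ σ v ≠ 0}
    (fun σ => ∑ k : Fin n, ((k : ℕ) : ℤ) * ((σ k : ℕ) : ℤ)) (Set.toFinite _)
    ⟨1, by rw [Set.mem_ofPred_eq, heckeW_one]; exact hv0⟩
  refine ⟨heckeW ρ σ v, (key σ).1, hσ, (key σ).2, fun i j h => ?_⟩
  have hsw : σ * Equiv.swap i j * Equiv.swap i j = σ := by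
    rw [mul_assoc, Equiv.swap_mul_self, mul_one]
  rcases lt_or_gt_of_ne (σ.injective.ne (ne_of_adj h)) with hlt | hlt
  · refine ⟨0, ?_⟩
    rw [zero_smul, ← heckeW_mul_swap σ h hlt]
    by_contra hne
    have h1 := hmin _ hne
    have h2 := sum_mul_swap_lt (σ * Equiv.swap i j) (lt_of_adj h) (by simpa using hlt)
    rw [hsw] at h2
    exact absurd h2 (not_lt.mpr h1)
  · have h1 := heckeW_mul_swap (ρ := ρ) (σ * Equiv.swap i j) h (by simpa using hlt) v
    rw [hsw] at h1
    obtain ⟨k1, k2⟩ := key (σ * Equiv.swap i j)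
    choose χ hχ using fun a : Fˣ => k2 (ta i j a) (dg_mem_tor _)
    exact ⟨_, by rw [h1]; exact hecke_hecke h hF (hKlo k1) hχ⟩

theorem span_up_eq_top
    (hirr : ∀ S : Submodule C V, (∀ (g : GL (Fin n) F) (v : V), v ∈ S → ρ g v ∈ S) →
      S = ⊥ ∨ S = ⊤) {v : V} (hv0 : v ≠ 0) (hv : v ∈ fix ρ (lo F n))
    (hT : ∀ t ∈ tor F n, ∃ c : C, ρ t v = c • v)
    (hY : ∀ (i j : Fin n) (h : (i : ℕ) + 1 = j), ∃ c : C, hecke ρ (ne_of_adj h) v = c • v) :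
    Submodule.span C ((fun u => ρ u v) '' (up F n : Set (GL (Fin n) F))) = ⊤ := by
  classical
  set W := Submodule.span C ((fun u => ρ u v) '' (up F n : Set (GL (Fin n) F))) with hW
  have hmem : ∀ u ∈ up F n, ρ u v ∈ W := fun u hu => Submodule.subset_span ⟨u, hu, rfl⟩
  have hvW : v ∈ W := by simpa using hmem 1 (Subgroup.one_mem _)
  have hst : ∀ g : GL (Fin n) F, (∀ u ∈ up F n, ρ g (ρ u v) ∈ W) → ∀ w ∈ W, ρ g w ∈ W := by
    intro g hg
    suffices W ≤ W.comap (ρ g) from this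
    rw [hW, Submodule.span_le]
    rintro _ ⟨u, hu, rfl⟩
    exact hg u hu
  have hup : ∀ x ∈ up F n, ∀ w ∈ W, ρ x w ∈ W := by
    intro x hx
    refine hst x fun u hu => ?_
    rw [rho_mul]
    exact hmem _ (Subgroup.mul_mem _ hx hu)
  have hall : ∀ g : GL (Fin n) F, ∀ w ∈ W, ρ g w ∈ W := by
    intro g
    refine gl_induction {g | ∀ w ∈ W, ρ g w ∈ W} ?_ ?_ ?_ ?_ g
    · intro w hw; simpa using hw
    · intro u hu x hx w hw
      rw [← rho_mul]
      exact hup u hu _ (hx w hw)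
    · intro t ht x hx w hw
      rw [← rho_mul]
      refine hst t (fun u hu => ?_) _ (hx w hw)
      obtain ⟨c, hc⟩ := hT t ht
      have e : t * u = t * u * t⁻¹ * t := by group
      rw [rho_mul, e, ← rho_mul, hc, map_smul]
      exact Submodule.smul_mem _ _ (hmem _ (conj_mem_rad (tor_le_par _ ht) hu))
    · intro i j h x hx w hw
      rw [← rho_mul]
      refine hst _ (fun u hu => ?_) _ (hx w hw)
      choose χ hχ using fun a : Fˣ => hT (ta i j a) (dg_mem_tor _)
      have hunit : ∀ a : Fˣ, ρ (pm F (Equiv.swap i j) * tv (ne_of_adj h) (a : F)) v ∈ W := by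
        intro a
        rw [rho_swap_tv h hv a (hχ a)]
        exact Submodule.smul_mem _ _ (hmem _ (tv_mem_up h _))
      have hs : ρ (pm F (Equiv.swap i j)) v ∈ W := by
        obtain ⟨c, hc⟩ := hY i j h
        rw [hecke_eq h hv hχ] at hc
        rw [eq_sub_of_add_eq hc]
        exact Submodule.sub_mem _ (Submodule.smul_mem _ _ hvW) (Submodule.sum_mem _ fun a _ =>
          Submodule.smul_mem _ _ (hmem _ (tv_mem_up h _)))
      obtain ⟨y, hy, a, rfl⟩ := exists_upper_split h hu
      have hy' := rad_mrg_le h (conj_mem_rad (swap_mem_par i j) hy)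
      set s := pm F (Equiv.swap i j)
      have e : s * (y * tv (ne_of_adj h) a) = s * y * s⁻¹ * (s * tv (ne_of_adj h) a) := by group
      rw [rho_mul, e, ← rho_mul]
      refine hup _ hy' _ ?_
      by_cases ha : a = 0
      · rw [ha, tv_zero, mul_one]; exact hs
      · exact hunit (Units.mk0 a ha)
  rcases hirr W (fun g w hw => hall g w hw) with h | h
  · rw [h, Submodule.mem_bot] at hvW
    exact absurd hvW hv0
  · exact h

end Hecke

section Lowest

variable {F : Type} [Field F] [Fintype F] {n : ℕ} {C : Type} [Field C]
  {V : Type} [AddCommGroup V] [Module C V] {ρ : Representation C (GL (Fin n) F) V}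

theorem swap_dichotomy [DecidableEq F] {i j : Fin n} (h : (i : ℕ) + 1 = j) (hF : (Fintype.card F : C) = 0)
    {v : V} (hv0 : v ≠ 0) (hv : v ∈ fix ρ (lo F n)) (hT : ∀ t ∈ tor F n, ∃ c : C, ρ t v = c • v)
    (hY : ∃ c : C, hecke ρ (ne_of_adj h) v = c • v) :
    (∃ c : C, ρ (pm F (Equiv.swap i j)) v = c • v) ∨
      ∃ f : Fˣ → V, ρ (pm F (Equiv.swap i j)) v =
        ∑ a : Fˣ, (ρ (tv (ne_of_adj h) (a : F)) (f a) - f a) := by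
  choose χ hχ using fun a : Fˣ => hT (ta i j a) (dg_mem_tor _)
  obtain ⟨l, hl⟩ := hY
  set s := pm F (Equiv.swap i j) with hs
  have hsq := hecke_hecke h hF hv hχ
  have heq := hecke_eq h hv hχ
  rw [← Equiv.sum_comp (Equiv.inv Fˣ)] at heq
  simp only [Equiv.inv_apply, inv_inv] at heq
  have hsum : ∑ a : Fˣ, χ a⁻¹ = ∑ a : Fˣ, χ a := Equiv.sum_comp (Equiv.inv Fˣ) χ
  set c := ∑ a : Fˣ, χ a with hc
  rw [hl, map_smul, hl, smul_smul, smul_smul, ← sub_eq_zero, ← sub_smul, smul_eq_zero,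
    or_iff_left hv0, ← sub_mul, mul_eq_zero, sub_eq_zero] at hsq
  rw [hl] at heq
  have heq' : ρ s v = l • v - ∑ a : Fˣ, χ a⁻¹ • ρ (tv (ne_of_adj h) (a : F)) v :=
    eq_sub_of_add_eq heq.symm
  by_cases hlc : l = c
  · right
    refine ⟨fun a => -(χ a⁻¹ • v), ?_⟩
    rw [heq', hlc, ← hsum, Finset.sum_smul, ← Finset.sum_sub_distrib]
    refine Finset.sum_congr rfl fun a _ => ?_
    rw [map_neg, map_smul, neg_sub_neg]
  · left
    have hl0 : l = 0 := hsq.resolve_left hlc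
    have hc0 : c ≠ 0 := fun hc0 => hlc (hl0.trans hc0.symm)
    choose ψ hψ using fun a : Fˣ => hT (coroot i j a) (dg_mem_tor _)
    have hmul : ∀ a d, χ (a * d) = ψ a * χ d := by
      intro a d
      have h1 := hχ (a * d)
      rw [ta_mul, ← rho_mul, hχ, map_smul, hψ, smul_smul, ← sub_eq_zero, ← sub_smul,
        smul_eq_zero, or_iff_left hv0, sub_eq_zero] at h1
      rw [← h1, mul_comm]
    have hψ1 : ∀ a, ψ a = 1 := by
      intro a
      have h1 : c = ψ a * c := by
        conv_lhs => rw [hc, ← Equiv.sum_comp (Equiv.mulLeft a) χ]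
        rw [hc, Finset.mul_sum]
        exact Finset.sum_congr rfl fun d _ => hmul a d
      exact (mul_eq_right₀ hc0).mp h1.symm
    have hχ1 : ∀ a, χ a = χ 1 := by
      intro a
      have := hmul a 1
      rwa [mul_one, hψ1, one_mul] at this
    have h0 : v + ∑ a : Fˣ, ρ (tv (ne_of_adj h) (a : F)) v = 0 := by
      have h1 : ρ s⁻¹ (hecke ρ (ne_of_adj h) v) = 0 := by
        rw [hl, hl0, zero_smul, map_zero]
      rw [hecke_apply, map_sum, sum_eq_add_sum_units, ← hs] at h1
      simpa only [rho_mul, inv_mul_cancel_left, tv_zero, map_one, Module.End.one_apply] using h1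
    refine ⟨χ 1, ?_⟩
    rw [heq', hl0, zero_smul, zero_sub, Finset.sum_congr rfl fun a _ => by rw [hχ1 a⁻¹],
      ← Finset.smul_sum, ← smul_neg, ← eq_neg_of_add_eq_zero_left h0]

theorem perm_dichotomy (hF : (Fintype.card F : C) = 0)
    {v : V} (hv0 : v ≠ 0) (hv : v ∈ fix ρ (lo F n)) (hT : ∀ t ∈ tor F n, ∃ c : C, ρ t v = c • v)
    (hY : ∀ (i j : Fin n) (h : (i : ℕ) + 1 = j), ∃ c : C, hecke ρ (ne_of_adj h) v = c • v)
    (w : Equiv.Perm (Fin n)) (hw : ρ (pm F w) v ∉ aug ρ (up F n)) :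
    ∃ c : C, ρ (pm F w) v = c • v := by
  classical
  revert hw
  refine perm_induction (fun w => ρ (pm F w) v ∉ aug ρ (up F n) → ∃ c : C, ρ (pm F w) v = c • v)
    ?_ ?_ w
  · intro _
    exact ⟨1, by simp⟩
  · intro w i j h hlt ih hw
    rw [map_mul, ← rho_mul] at hw ⊢
    rcases swap_dichotomy h hF hv0 hv hT (hY i j h) with ⟨c, hc⟩ | ⟨f, hf⟩
    · rw [hc, map_smul] at hw ⊢
      obtain ⟨d, hd⟩ := ih fun hmem => hw (Submodule.smul_mem _ _ hmem)
      exact ⟨c * d, by rw [hd, smul_smul]⟩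
    · refine absurd ?_ hw
      rw [hf, map_sum]
      refine Submodule.sum_mem _ fun a _ => ?_
      have hmem : tv (w.injective.ne (ne_of_adj h)) (a : F) ∈ up F n := tv_mem_rad _ _ hlt
      rw [map_sub, rho_mul, pm_mul_tv, ← rho_mul]
      exact sub_mem_aug hmem _

omit [Fintype F] in
theorem exists_sub_smul_mem_aug {v : V}
    (hspan : Submodule.span C ((fun u => ρ u v) '' (up F n : Set (GL (Fin n) F))) = ⊤) (x : V) :
    ∃ c : C, x - c • v ∈ aug ρ (up F n) := by
  have hx : x ∈ Submodule.span C ((fun u => ρ u v) '' (up F n : Set (GL (Fin n) F))) :=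
    hspan ▸ trivial
  induction hx using Submodule.span_induction with
  | mem x hx =>
    obtain ⟨u, hu, rfl⟩ := hx
    exact ⟨1, by rw [one_smul]; exact sub_mem_aug hu v⟩
  | zero => exact ⟨0, by simp⟩
  | add x y _ _ hx hy =>
    obtain ⟨c, hc⟩ := hx
    obtain ⟨d, hd⟩ := hy
    refine ⟨c + d, ?_⟩
    have := Submodule.add_mem _ hc hd
    rwa [← add_sub_add_comm, ← add_smul] at this
  | smul a x _ hx =>
    obtain ⟨c, hc⟩ := hx
    refine ⟨a * c, ?_⟩
    rw [mul_smul, ← smul_sub]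
    exact Submodule.smul_mem _ _ hc

/-- The properties of the line of lower unipotent invariants in an irreducible representation. -/
structure IsLowest (ρ : Representation C (GL (Fin n) F) V) (v : V) : Prop where
  ne_zero : v ≠ 0
  mem : v ∈ fix ρ (lo F n)
  eq_smul : ∀ w ∈ fix ρ (lo F n), ∃ c : C, w = c • v
  span : Submodule.span C ((fun u => ρ u v) '' (up F n : Set (GL (Fin n) F))) = ⊤
  disj : fix ρ (lo F n) ⊓ aug ρ (up F n) = ⊥
  perm : ∀ w : Equiv.Perm (Fin n), ρ (pm F w) v ∉ aug ρ (up F n) → ∃ c : C, ρ (pm F w) v = c • v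

theorem exists_isLowest (p : ℕ) [Fact p.Prime] [CharP F p] [CharP C p] [IsAlgClosed C]
    [Nontrivial V]
    (hirr : ∀ S : Submodule C V, (∀ (g : GL (Fin n) F) (v : V), v ∈ S → ρ g v ∈ S) →
      S = ⊥ ∨ S = ⊤) : ∃ v, IsLowest ρ v := by
  have hfd : FiniteDimensional C V := finiteDimensional_of_irreducible hirr
  have hF : (Fintype.card F : C) = 0 := by
    obtain ⟨m, -, hm⟩ := FiniteField.card F p
    rw [hm, Nat.cast_pow, CharP.cast_eq_zero, zero_pow m.ne_zero]
  have hTlo : ∀ t ∈ tor F n, ∀ v ∈ fix ρ (lo F n), ρ t v ∈ fix ρ (lo F n) := fun t ht v hv =>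
    rho_mem_fix (fun u hu => conj_inv_mem_rad (tor_le_par _ ht) hu) hv
  have hdisj : fix ρ (lo F n) ⊓ aug ρ (up F n) = ⊥ := by
    by_contra hne
    obtain ⟨v, hvK, hv0, hT, hY⟩ := exists_hecke_eigenvector hF hne inf_le_left
      (fun t ht v hv => ⟨hTlo t ht v hv.1,
        rho_mem_aug (fun u hu => conj_mem_rad (tor_le_par _ ht) hu) hv.2⟩)
      (fun i j h v hv => ⟨hecke_mem_fix h hv.1, hecke_mem_aug h hv.2⟩)
    refine aug_ne_top (ρ := ρ) p (isPGroup_rad (F := F) p (id : Fin n → Fin n)) ?_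
    rw [eq_top_iff, ← span_up_eq_top hirr hv0 hvK.1 hT hY, Submodule.span_le]
    rintro _ ⟨u, hu, rfl⟩
    exact (rho_mem_aug_self hu).mpr hvK.2
  have hne : fix ρ (lo F n) ≠ ⊥ := by
    obtain ⟨v, -, hv0, hv⟩ := exists_fixed (ρ := ρ) p (K := ⊤)
      (isPGroup_rad (F := F) p (OrderDual.toDual : Fin n → (Fin n)ᵒᵈ)) top_ne_bot
      (fun _ _ _ _ => trivial)
    exact (Submodule.ne_bot_iff _).mpr ⟨v, hv, hv0⟩
  obtain ⟨v, hv, hv0, hT, hY⟩ := exists_hecke_eigenvector hF hne le_rfl hTlo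
    (fun i j h v hv => hecke_mem_fix h hv)
  have hspan := span_up_eq_top hirr hv0 hv hT hY
  refine ⟨v, hv0, hv, fun w hw => ?_, hspan, hdisj, perm_dichotomy hF hv0 hv hT hY⟩
  obtain ⟨c, hc⟩ := exists_sub_smul_mem_aug hspan w
  refine ⟨c, ?_⟩
  have : w - c • v ∈ fix ρ (lo F n) ⊓ aug ρ (up F n) :=
    ⟨Submodule.sub_mem _ hw (Submodule.smul_mem _ _ hv), hc⟩
  rw [hdisj, Submodule.mem_bot, sub_eq_zero] at this
  exact this

end Lowest

section Blocks

variable {F : Type} [Field F] {n : ℕ} {b : Fin n → ℕ}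

/-- The block diagonal subgroup. -/
def lev (F : Type) [Field F] {n : ℕ} (b : Fin n → ℕ) : Subgroup (GL (Fin n) F) :=
  par F b ⊓ par F (OrderDual.toDual ∘ b)

theorem exists_block_split {α : Type} [LinearOrder α] {c : Fin n → α} {d : Fin n → ℕ}
    {β : Type} [LinearOrder β] {e : ℕ → β} (he : Function.Injective e)
    (hcd : ∀ i j, c i < c j → (e ∘ d) i ≤ (e ∘ d) j) {u : GL (Fin n) F} (hu : u ∈ rad F c) :
    ∃ x ∈ rad F (e ∘ d), ∃ m ∈ rad F c, m ∈ lev F d ∧ u = x * m := by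
  obtain ⟨x, hx, m, hm, rfl, hmij⟩ := exists_rad_mul hcd hu
  refine ⟨x, hx, m, hm, ⟨mem_par.mpr fun i j h => ?_, mem_par.mpr fun i j h => ?_⟩, rfl⟩
  · rw [hmij, if_neg (show ¬ (e ∘ d) i = (e ∘ d) j from fun h' => h.ne (he h').symm)]
  · rw [hmij, if_neg (show ¬ (e ∘ d) i = (e ∘ d) j from fun h' => (OrderDual.toDual_lt_toDual.mp h).ne (he h'))]

theorem exists_upper_block_split (hb : Monotone b) {u : GL (Fin n) F} (hu : u ∈ up F n) :
    ∃ x ∈ rad F b, ∃ m ∈ up F n, m ∈ lev F b ∧ u = x * m :=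
  exists_block_split (e := id) Function.injective_id (fun _ _ h => hb (le_of_lt h)) hu

theorem exists_lower_block_split (hb : Monotone b) {u : GL (Fin n) F} (hu : u ∈ lo F n) :
    ∃ x ∈ rad F (OrderDual.toDual ∘ b), ∃ m ∈ lo F n, m ∈ lev F b ∧ u = x * m :=
  exists_block_split (e := OrderDual.toDual) OrderDual.toDual.injective
    (fun _ _ h => hb (le_of_lt (OrderDual.toDual_lt_toDual.mp h))) hu

theorem rad_le_up (hb : Monotone b) : rad F b ≤ up F n :=
  rad_mono fun _ _ h => hb.reflect_lt h

theorem rad_dual_le_lo (hb : Monotone b) : rad F (OrderDual.toDual ∘ b) ≤ lo F n :=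
  rad_mono fun _ _ h => hb.reflect_lt h

theorem up_le_par (hb : Monotone b) : up F n ≤ par F b :=
  (rad_le_par _).trans (par_mono fun _ _ h => hb.reflect_lt h)

theorem par_dual_le (hb : Monotone b) :
    par F (OrderDual.toDual : Fin n → (Fin n)ᵒᵈ) ≤ par F (OrderDual.toDual ∘ b) :=
  par_mono fun _ _ h => hb.reflect_lt h

variable [Fintype F] {C : Type} [Field C]
  {V : Type} [AddCommGroup V] [Module C V] {ρ : Representation C (GL (Fin n) F) V} {v : V}

omit [Fintype F] in
theorem rho_mem_aug_rad {x : GL (Fin n) F} (hx : x ∈ par F b) {w : V} :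
    ρ x w ∈ aug ρ (rad F b) ↔ w ∈ aug ρ (rad F b) := by
  constructor
  · intro h
    have := rho_mem_aug (fun u hu => conj_mem_rad ((par F b).inv_mem hx) hu) h
    rwa [rho_inv_self] at this
  · exact rho_mem_aug fun u hu => conj_mem_rad hx hu

omit [Fintype F] in
theorem rho_mem_fix_rad {x : GL (Fin n) F} (hx : x ∈ par F (OrderDual.toDual ∘ b)) {w : V}
    (hw : w ∈ fix ρ (rad F (OrderDual.toDual ∘ b))) :
    ρ x w ∈ fix ρ (rad F (OrderDual.toDual ∘ b)) :=
  rho_mem_fix (fun _ hu => conj_inv_mem_rad hx hu) hw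

omit [Fintype F] in
theorem IsLowest.mem_fix_rad (hv : IsLowest ρ v) (hb : Monotone b) :
    v ∈ fix ρ (rad F (OrderDual.toDual ∘ b)) :=
  fix_mono (rad_dual_le_lo hb) hv.mem

/-- A Levi stable space of `N̄`-invariants meeting no lower invariants outside zero vanishes. -/
theorem IsLowest.eq_bot (p : ℕ) [Fact p.Prime] [CharP F p] [CharP C p] (hv : IsLowest ρ v)
    (hb : Monotone b) {K : Submodule C V} (hK : K ≤ fix ρ (rad F (OrderDual.toDual ∘ b)))
    (hK' : K ≤ aug ρ (up F n)) (hst : ∀ m ∈ lev F b, ∀ w ∈ K, ρ m w ∈ K) : K = ⊥ := by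
  by_contra hne
  obtain ⟨w, hwK, hw0, hw⟩ := exists_fixed (ρ := ρ) p (H := lo F n ⊓ lev F b)
    ((isPGroup_rad p _).to_le inf_le_left) hne (fun m hm w hw => hst m hm.2 w hw)
  have hwlo : w ∈ fix ρ (lo F n) := by
    intro u hu
    obtain ⟨x, hx, m, hm, hml, rfl⟩ := exists_lower_block_split hb hu
    rw [← rho_mul, hw m ⟨hm, hml⟩, hK hwK x hx]
  have : w ∈ fix ρ (lo F n) ⊓ aug ρ (up F n) := ⟨hwlo, hK' hwK⟩
  rw [hv.disj, Submodule.mem_bot] at this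
  exact hw0 this

theorem IsLowest.fix_inf_aug (p : ℕ) [Fact p.Prime] [CharP F p] [CharP C p] (hv : IsLowest ρ v)
    (hb : Monotone b) :
    fix ρ (rad F (OrderDual.toDual ∘ b)) ⊓ aug ρ (rad F b) = ⊥ :=
  hv.eq_bot p hb inf_le_left (inf_le_right.trans (aug_mono (rad_le_up hb)))
    fun _ hm _ hw => ⟨rho_mem_fix_rad hm.2 hw.1, (rho_mem_aug_rad hm.1).mpr hw.2⟩

omit [Fintype F] in
theorem IsLowest.exists_span (hv : IsLowest ρ v) (hb : Monotone b) (x : V) :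
    ∃ y ∈ Submodule.span C ((fun m => ρ m v) '' ((up F n ⊓ lev F b : Subgroup (GL (Fin n) F)) :
      Set (GL (Fin n) F))), x - y ∈ aug ρ (rad F b) := by
  have hx : x ∈ Submodule.span C ((fun u => ρ u v) '' (up F n : Set (GL (Fin n) F))) :=
    hv.span ▸ trivial
  induction hx using Submodule.span_induction with
  | mem x hx =>
    obtain ⟨u, hu, rfl⟩ := hx
    obtain ⟨x, hx, m, hm, hml, rfl⟩ := exists_upper_block_split hb hu
    refine ⟨ρ m v, Submodule.subset_span ⟨m, ⟨hm, hml⟩, rfl⟩, ?_⟩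
    simp only [← rho_mul]
    exact sub_mem_aug hx _
  | zero => exact ⟨0, Submodule.zero_mem _, by simp⟩
  | add x y _ _ hx hy =>
    obtain ⟨c, hc, hc'⟩ := hx
    obtain ⟨d, hd, hd'⟩ := hy
    refine ⟨c + d, Submodule.add_mem _ hc hd, ?_⟩
    rw [add_sub_add_comm]
    exact Submodule.add_mem _ hc' hd'
  | smul a x _ hx =>
    obtain ⟨c, hc, hc'⟩ := hx
    refine ⟨a • c, Submodule.smul_mem _ _ hc, ?_⟩
    rw [← smul_sub]
    exact Submodule.smul_mem _ _ hc'

omit [Fintype F] in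
theorem IsLowest.span_le (hv : IsLowest ρ v) (hb : Monotone b) :
    Submodule.span C ((fun m => ρ m v) '' ((up F n ⊓ lev F b : Subgroup (GL (Fin n) F)) :
      Set (GL (Fin n) F))) ≤ fix ρ (rad F (OrderDual.toDual ∘ b)) := by
  rw [Submodule.span_le]
  rintro _ ⟨m, hm, rfl⟩
  exact rho_mem_fix_rad hm.2.2 (hv.mem_fix_rad hb)

omit [Fintype F] in
theorem IsLowest.exists_fix (hv : IsLowest ρ v) (hb : Monotone b) (x : V) :
    ∃ y ∈ fix ρ (rad F (OrderDual.toDual ∘ b)), x - y ∈ aug ρ (rad F b) := by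
  obtain ⟨y, hy, hxy⟩ := hv.exists_span hb x
  exact ⟨y, hv.span_le hb hy, hxy⟩

theorem IsLowest.fix_le_span (p : ℕ) [Fact p.Prime] [CharP F p] [CharP C p] (hv : IsLowest ρ v)
    (hb : Monotone b) : fix ρ (rad F (OrderDual.toDual ∘ b)) ≤
      Submodule.span C ((fun m => ρ m v) '' ((up F n ⊓ lev F b : Subgroup (GL (Fin n) F)) :
      Set (GL (Fin n) F))) := by
  intro x hx
  obtain ⟨y, hy, hxy⟩ := hv.exists_span hb x
  have : x - y ∈ fix ρ (rad F (OrderDual.toDual ∘ b)) ⊓ aug ρ (rad F b) :=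
    ⟨Submodule.sub_mem _ hx (hv.span_le hb hy), hxy⟩
  rw [hv.fix_inf_aug p hb, Submodule.mem_bot, sub_eq_zero] at this
  exact this ▸ hy

theorem IsLowest.exists_lev (p : ℕ) [Fact p.Prime] [CharP F p] [CharP C p] (hv : IsLowest ρ v)
    (hb : Monotone b) {x : V} (hx : x ∉ aug ρ (rad F b)) :
    ∃ h ∈ lev F b, ρ h x ∉ aug ρ (up F n) := by
  by_contra! hall
  obtain ⟨y, hy, hxy⟩ := hv.exists_fix hb x
  have hyup : ∀ h ∈ lev F b, ρ h y ∈ aug ρ (up F n) := by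
    intro h hh
    have h1 := aug_mono (rad_le_up hb) ((rho_mem_aug_rad hh.1).mpr hxy)
    rw [map_sub] at h1
    exact (Submodule.sub_mem_iff_right _ (hall h hh)).mp h1
  have hbot := hv.eq_bot p hb
    (K := Submodule.span C ((fun m => ρ m y) '' (lev F b : Set (GL (Fin n) F))))
    (by
      rw [Submodule.span_le]
      rintro _ ⟨m, hm, rfl⟩
      exact rho_mem_fix_rad hm.2 hy)
    (by
      rw [Submodule.span_le]
      rintro _ ⟨m, hm, rfl⟩
      exact hyup m hm)
    (by
      intro m hm
      refine Submodule.span_le (p := (Submodule.span C _).comap (ρ m)) |>.mpr ?_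
      rintro _ ⟨k, hk, rfl⟩
      exact Submodule.subset_span ⟨m * k, Subgroup.mul_mem _ hm hk, (rho_mul _ _ _).symm⟩)
  have hy0 : y = 0 := by
    rw [← Submodule.mem_bot C, ← hbot]
    exact Submodule.subset_span ⟨1, Subgroup.one_mem _, by simp⟩
  rw [hy0, sub_zero] at hxy
  exact hx hxy

theorem IsLowest.exists_image_iff (p : ℕ) [Fact p.Prime] [CharP F p] [CharP C p]
    (hv : IsLowest ρ v) (hb : Monotone b) (g : GL (Fin n) F) :
    (∃ w ∈ fix ρ (rad F (OrderDual.toDual ∘ b)), ρ g w ∉ aug ρ (rad F b)) ↔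
      ∃ x ∈ par F b, ∃ y : GL (Fin n) F, Submodule.map (ρ y : V →ₗ[C] V) (fix ρ (lo F n)) =
        fix ρ (lo F n) ∧ ∃ z ∈ par F (OrderDual.toDual ∘ b), g = x * y * z := by
  constructor
  · rintro ⟨w, hw, hgw⟩
    obtain ⟨m, hm, hgm⟩ : ∃ m ∈ up F n ⊓ lev F b, ρ g (ρ m v) ∉ aug ρ (rad F b) := by
      by_contra! hall
      refine hgw ((Submodule.span_le (p := (aug ρ (rad F b)).comap (ρ g)) |>.mpr ?_)
        (hv.fix_le_span p hb hw))
      rintro _ ⟨m, hm, rfl⟩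
      exact hall m hm
    obtain ⟨h, hh, hhg⟩ := hv.exists_lev p hb hgm
    obtain ⟨u, hu, σ, y, hy, e⟩ := exists_bruhat (h * g * m)
    rw [rho_mul, rho_mul, e, ← rho_mul, ← rho_mul, rho_mem_aug_self hu] at hhg
    obtain ⟨c, hc⟩ := hv.eq_smul (ρ y v)
      (rho_mem_fix (fun _ hk => conj_inv_mem_rad hy hk) hv.mem)
    rw [hc, map_smul] at hhg
    obtain ⟨d, hd⟩ := hv.perm σ fun hmem => hhg (Submodule.smul_mem _ _ hmem)
    have hd0 : d ≠ 0 := by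
      rintro rfl
      rw [zero_smul] at hd
      exact rho_ne_zero _ hv.ne_zero hd
    refine ⟨h⁻¹ * u, Subgroup.mul_mem _ (Subgroup.inv_mem _ hh.1) (up_le_par hb hu), pm F σ, ?_,
      y * m⁻¹, Subgroup.mul_mem _ (par_dual_le hb hy) (Subgroup.inv_mem _ hm.2.2), ?_⟩
    · apply le_antisymm
      · rintro _ ⟨x, hx, rfl⟩
        obtain ⟨a, rfl⟩ := hv.eq_smul x hx
        rw [map_smul, hd]
        exact Submodule.smul_mem _ _ (Submodule.smul_mem _ _ hv.mem)
      · intro x hx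
        obtain ⟨a, rfl⟩ := hv.eq_smul x hx
        refine ⟨(a * d⁻¹) • v, Submodule.smul_mem _ _ hv.mem, ?_⟩
        rw [map_smul, hd, smul_smul, inv_mul_cancel_right₀ hd0]
    · have e' : g = h⁻¹ * (h * g * m) * m⁻¹ := by group
      rw [e', e]
      group
  · rintro ⟨x, hx, y, hy, z, hz, rfl⟩
    refine ⟨ρ z⁻¹ v, rho_mem_fix_rad (Subgroup.inv_mem _ hz) (hv.mem_fix_rad hb), ?_⟩
    rw [rho_mul, mul_inv_cancel_right, ← rho_mul, rho_mem_aug_rad hx]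
    intro hmem
    have h1 : ρ y v ∈ fix ρ (lo F n) ⊓ aug ρ (up F n) :=
      ⟨hy ▸ Submodule.mem_map_of_mem hv.mem, aug_mono (rad_le_up hb) hmem⟩
    rw [hv.disj, Submodule.mem_bot] at h1
    exact rho_ne_zero y hv.ne_zero h1

end Blocks

section Sets

variable {F : Type} [Field F] {n : ℕ} {α : Type} [LinearOrder α]

theorem mem_rad_iff {c : Fin n → α} {g : GL (Fin n) F} :
    g ∈ rad F c ↔ (∀ i j, c j < c i → (g : Matrix (Fin n) (Fin n) F) i j = 0) ∧
      ∀ i j, c i = c j → (g : Matrix (Fin n) (Fin n) F) i j = if i = j then (1 : F) else 0 := by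
  rw [mem_rad]
  constructor
  · intro h
    refine ⟨fun i j hij => ?_, fun i j hij => ?_⟩
    · rw [h i j (not_lt.mpr hij.le), one_apply_ne]
      rintro rfl
      exact lt_irrefl _ hij
    · rw [h i j hij.not_lt, one_apply]
  · rintro ⟨h1, h2⟩ i j hij
    rcases (not_lt.mp hij).lt_or_eq with h | h
    · rw [h1 i j h, one_apply_ne]
      rintro rfl
      exact lt_irrefl _ h
    · rw [h2 i j h.symm, one_apply]

theorem mem_lo_iff {g : GL (Fin n) F} :
    g ∈ lo F n ↔ (∀ i j : Fin n, i < j → (g : Matrix (Fin n) (Fin n) F) i j = 0) ∧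
      ∀ i : Fin n, (g : Matrix (Fin n) (Fin n) F) i i = 1 := by
  rw [mem_rad_iff]
  refine and_congr Iff.rfl ⟨fun h i => by rw [h i i rfl, if_pos rfl], ?_⟩
  rintro h i j hij
  obtain rfl : i = j := OrderDual.toDual.injective hij
  rw [h, if_pos rfl]

end Sets

end GLFix

/-!
STATEMENT 13.  Same setting (`G = GL_n(F_q)`, `V` irreducible over an algebraically closed
field `C` of characteristic `p`); a composition of `n` is encoded by a monotone block
function `b : Fin n → ℕ`, determining `P = MN` (block upper) and `P̄ = MN̄` (block lower);
`Ū` is the full lower unitriangular subgroup and `P̄_V` the stabilizer of `V^{Ū}`.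

(i)  the composite `V^{N̄} ⊆ V → V_N` is a `C`-linear isomorphism of `V^{N̄}` onto `V_N`;
(ii) for `g ∈ G`, the image of `g·V^{N̄}` in `V_N` is nonzero iff `g ∈ P · P̄_V · P̄`.
-/
theorem statement13 (p : ℕ) (hp : p.Prime) (q r : ℕ) (hr : 0 < r) (hq : q = p ^ r)
    (𝔽 : Type) [Field 𝔽] [Fintype 𝔽] (hcard : Fintype.card 𝔽 = q)
    (C : Type) [Field C] [IsAlgClosed C] (hC : CharP C p)
    (n : ℕ) (hn : 1 ≤ n)
    (V : Type) [AddCommGroup V] [Module C V] [Nontrivial V]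
    (ρ : Representation C (GL (Fin n) 𝔽) V)
    (hirr : ∀ S : Submodule C V, (∀ (g : GL (Fin n) 𝔽) (v : V), v ∈ S → ρ g v ∈ S) →
      S = ⊥ ∨ S = ⊤)
    (b : Fin n → ℕ) (hb : Monotone b) :
    -- the full lower unitriangular subgroup Ū
    let Ubar : Set (GL (Fin n) 𝔽) :=
      {g | (∀ i j : Fin n, i < j → (↑g : Matrix (Fin n) (Fin n) 𝔽) i j = 0) ∧
        ∀ i : Fin n, (↑g : Matrix (Fin n) (Fin n) 𝔽) i i = 1}
    -- the standard parabolic P (block upper triangular)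
    let P : Set (GL (Fin n) 𝔽) :=
      {g | ∀ i j : Fin n, b j < b i → (↑g : Matrix (Fin n) (Fin n) 𝔽) i j = 0}
    -- the opposite parabolic P̄ (block lower triangular)
    let Pbar : Set (GL (Fin n) 𝔽) :=
      {g | ∀ i j : Fin n, b i < b j → (↑g : Matrix (Fin n) (Fin n) 𝔽) i j = 0}
    -- the unipotent radical N (block upper unitriangular)
    let N : Set (GL (Fin n) 𝔽) :=
      {g | (∀ i j : Fin n, b j < b i → (↑g : Matrix (Fin n) (Fin n) 𝔽) i j = 0) ∧
        ∀ i j : Fin n, b i = b j →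
          (↑g : Matrix (Fin n) (Fin n) 𝔽) i j = if i = j then (1 : 𝔽) else 0}
    -- the opposite unipotent radical N̄
    let Nbar : Set (GL (Fin n) 𝔽) :=
      {g | (∀ i j : Fin n, b i < b j → (↑g : Matrix (Fin n) (Fin n) 𝔽) i j = 0) ∧
        ∀ i j : Fin n, b i = b j →
          (↑g : Matrix (Fin n) (Fin n) 𝔽) i j = if i = j then (1 : 𝔽) else 0}
    -- V^{Ū}
    let fixUbar : Submodule C V :=
      { carrier := {v | ∀ g ∈ Ubar, ρ g v = v}
        add_mem' := by intro v w hv hw g hg; rw [map_add, hv g hg, hw g hg]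
        zero_mem' := by intro g hg; rw [map_zero]
        smul_mem' := by intro c v hv g hg; rw [_root_.map_smul, hv g hg] }
    -- V^{N̄}
    let fixNbar : Submodule C V :=
      { carrier := {v | ∀ g ∈ Nbar, ρ g v = v}
        add_mem' := by intro v w hv hw g hg; rw [map_add, hv g hg, hw g hg]
        zero_mem' := by intro g hg; rw [map_zero]
        smul_mem' := by intro c v hv g hg; rw [_root_.map_smul, hv g hg] }
    -- the subspace of V defining the coinvariants V_N = V / coinvN
    let coinvN : Submodule C V :=
      Submodule.span C {x | ∃ g ∈ N, ∃ v : V, x = ρ g v - v}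
    -- P̄_V, the stabilizer of V^{Ū}
    let PbarV : Set (GL (Fin n) 𝔽) :=
      {g | Submodule.map (ρ g : V →ₗ[C] V) fixUbar = fixUbar}
    -- (i)
    (Function.Bijective
      (fun v : ↥fixNbar => Submodule.Quotient.mk (p := coinvN) (v : V))) ∧
    -- (ii)
    (∀ g : GL (Fin n) 𝔽,
      (∃ v ∈ fixNbar, Submodule.Quotient.mk (p := coinvN) (ρ g v) ≠ 0) ↔
      ∃ x ∈ P, ∃ y ∈ PbarV, ∃ z ∈ Pbar, g = x * y * z) := by
  have : Fact p.Prime := ⟨hp⟩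
  have : CharP 𝔽 p := charP_of_card_eq_prime_pow (hcard.trans hq)
  obtain ⟨v, hv⟩ := GLFix.exists_isLowest p hirr
  intro Ubar P Pbar N Nbar fixUbar fixNbar coinvN PbarV
  have hU : fixUbar = GLFix.fix ρ (GLFix.lo 𝔽 n) := by
    ext x
    exact ⟨fun h g hg => h g (GLFix.mem_lo_iff.mp hg), fun h g hg => h g (GLFix.mem_lo_iff.mpr hg)⟩
  have hN : fixNbar = GLFix.fix ρ (GLFix.rad 𝔽 (OrderDual.toDual ∘ b)) := by
    ext x
    exact ⟨fun h g hg => h g (GLFix.mem_rad_iff.mp hg),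
      fun h g hg => h g (GLFix.mem_rad_iff.mpr hg)⟩
  have hco : coinvN = GLFix.aug ρ (GLFix.rad 𝔽 b) := by
    refine congrArg (Submodule.span C) (Set.ext fun x => exists_congr fun g => and_congr_left' ?_)
    exact GLFix.mem_rad_iff.symm
  refine ⟨⟨fun x y hxy => ?_, fun x => ?_⟩, fun g => ?_⟩
  · have h1 := (Submodule.Quotient.eq coinvN).mp hxy
    have h2 : (x : V) - y ∈ GLFix.fix ρ (GLFix.rad 𝔽 (OrderDual.toDual ∘ b)) ⊓
        GLFix.aug ρ (GLFix.rad 𝔽 b) :=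
      ⟨hN ▸ Submodule.sub_mem _ x.2 y.2, hco ▸ h1⟩
    rw [hv.fix_inf_aug p hb, Submodule.mem_bot, sub_eq_zero] at h2
    exact Subtype.ext h2
  · obtain ⟨x, rfl⟩ := Submodule.Quotient.mk_surjective _ x
    obtain ⟨y, hy, hxy⟩ := hv.exists_fix hb x
    exact ⟨⟨y, hN ▸ hy⟩, ((Submodule.Quotient.eq coinvN).mpr (hco ▸ hxy)).symm⟩
  · have h1 := hv.exists_image_iff p hb g
    rw [← hN, ← hco, ← hU] at h1
    simp only [ne_eq, Submodule.Quotient.mk_eq_zero]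
    refine h1.trans ?_
    refine exists_congr fun x => and_congr GLFix.mem_par (exists_congr fun y => and_congr Iff.rfl
      (exists_congr fun z => and_congr GLFix.mem_par Iff.rfl))
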